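/- arXiv:2109.06152 — 5 statements merged into one kernel-verified Lean document; each statement's English description precedes it below -/
import Mathlib

section
/- There is an absolute constant d₀ such that the following holds. Let F be a finite abelian group of order 2n, X a subgroup of F of index 2 with coset Y = F \ X, and D ⊆ Y a generating set of F with D = −D, |D| = d, d₀ ≤ d ≤ n^{1/3}. Let D' ⊆ D with |D'| ≥ d − √d / log d, let u ∈ F, and let M ⊆ F be a set contained in one of the two cosets of X, with M ⊇ {u} + D' and |M| ≤ n/2. Then |M + D| ≥ |M| + |2D|/6. -/
open Pointwise Real

/-- Intersecting atoms coincide. -/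
lemma atom_inter {F : Type} [AddCommGroup F] [DecidableEq F]
    (XF S : Finset F) (κ : ℕ)
    (hκ : ∀ A : Finset F, A.Nonempty → A ⊆ XF → (A + S).card < XF.card →
      A.card + κ ≤ (A + S).card)
    (m : ℕ) (hm : ∀ A : Finset F, A.Nonempty → A ⊆ XF → (A + S).card < XF.card →
      (A + S).card = A.card + κ → m ≤ A.card)
    (hN : 2 * m + κ ≤ XF.card)
    (A B : Finset F) (hA : A ⊆ XF) (hB : B ⊆ XF)
    (hAc : A.card = m) (hBc : B.card = m)
    (hAS : (A + S).card = m + κ) (hBS : (B + S).card = m + κ) (hAN : (A + S).card < XF.card)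
    (hne : (A ∩ B).Nonempty) : A = B := by
  have h1 : (A ∩ B) + S ⊆ (A + S) ∩ (B + S) := Finset.inter_add_subset
  have h2 : (A ∪ B) + S = (A + S) ∪ (B + S) := Finset.union_add
  have h3 := Finset.card_union_add_card_inter (A + S) (B + S)
  have h4 := Finset.card_union_add_card_inter A B
  have h5 := Finset.card_le_card h1
  rw [← h2] at h3
  have h6 : ((A ∩ B) + S).card < XF.card :=
    lt_of_le_of_lt (Finset.card_le_card (Finset.add_subset_add_right Finset.inter_subset_left)) hAN
  have h7 := hκ _ hne (Finset.inter_subset_left.trans hA) h6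
  have h8 : 0 < (A ∩ B).card := hne.card_pos
  have h9 : ((A ∪ B) + S).card < XF.card := by omega
  have h10 := hκ (A ∪ B) (hne.mono (Finset.inter_subset_left.trans Finset.subset_union_left))
    (Finset.union_subset hA hB) h9
  have h11 := hm _ hne (Finset.inter_subset_left.trans hA) h6 (by omega)
  have e1 : A ∩ B = A := Finset.eq_of_subset_of_card_le Finset.inter_subset_left (by omega)
  have e2 : A ∩ B = B := Finset.eq_of_subset_of_card_le Finset.inter_subset_right (by omega)
  rw [← e1, e2]

/-- Olson's theorem for symmetric sets in finite abelian groups. -/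
lemma olson {F : Type} [AddCommGroup F] [Fintype F] [DecidableEq F] (X : AddSubgroup F)
    (XF S : Finset F) (hXF : ∀ x, x ∈ XF ↔ x ∈ X) (h0 : (0 : F) ∈ S)
    (hsym : ∀ x ∈ S, -x ∈ S) (hcl : AddSubgroup.closure (S : Set F) = X)
    (A : Finset F) (hAne : A.Nonempty) (hAX : A ⊆ XF) (hAS : (A + S).card < XF.card) :
    2 * A.card + S.card ≤ 2 * (A + S).card := by
  have hSX : ∀ s ∈ S, s ∈ X := fun s hs => hcl ▸ AddSubgroup.subset_closure hs
  have hle : ∀ B : Finset F, B.card ≤ (B + S).card := fun B =>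
    Finset.card_le_card (fun x hx => by simpa using Finset.add_mem_add hx h0)
  classical
  let good : Finset (Finset F) := Finset.univ.filter
    (fun B => B.Nonempty ∧ B ⊆ XF ∧ (B + S).card < XF.card)
  have hgood : ∀ B, B ∈ good ↔ B.Nonempty ∧ B ⊆ XF ∧ (B + S).card < XF.card := by
    intro B; simp [good]
  obtain ⟨A1, hA1, hmin1⟩ := Finset.exists_min_image good (fun B => (B + S).card - B.card)
    ⟨A, (hgood A).2 ⟨hAne, hAX, hAS⟩⟩
  obtain ⟨κ, hκdef⟩ : ∃ κ, κ = (A1 + S).card - A1.card := ⟨_, rfl⟩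
  have hκ : ∀ B : Finset F, B.Nonempty → B ⊆ XF → (B + S).card < XF.card →
      B.card + κ ≤ (B + S).card := by
    intro B h1 h2 h3
    have := hmin1 B ((hgood B).2 ⟨h1, h2, h3⟩)
    have := hle B
    omega
  obtain ⟨A0, hA0, hmin0⟩ := Finset.exists_min_image
    (good.filter (fun B => (B + S).card = B.card + κ)) (fun B => B.card)
    ⟨A1, by have := hle A1; simp only [Finset.mem_filter]; exact ⟨hA1, by omega⟩⟩
  rw [Finset.mem_filter, hgood] at hA0
  obtain ⟨⟨hne0, hX0, hlt0⟩, hfr0⟩ := hA0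
  have hm : ∀ B : Finset F, B.Nonempty → B ⊆ XF → (B + S).card < XF.card →
      (B + S).card = B.card + κ → A0.card ≤ B.card := by
    intro B h1 h2 h3 h4
    exact hmin0 B (by rw [Finset.mem_filter, hgood]; exact ⟨⟨h1, h2, h3⟩, h4⟩)
  have hsubX : ∀ B : Finset F, B ⊆ XF → B + S ⊆ XF := by
    intro B hB x hx
    obtain ⟨b, hb, s, hs, rfl⟩ := Finset.mem_add.1 hx
    exact (hXF _).2 (X.add_mem ((hXF _).1 (hB hb)) (hSX s hs))
  have hN : 2 * A0.card + κ ≤ XF.card := by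
    have hBS : (XF \ (A0 + S)) + S ⊆ XF \ A0 := by
      intro x hx
      obtain ⟨b, hb, s, hs, rfl⟩ := Finset.mem_add.1 hx
      rw [Finset.mem_sdiff] at hb ⊢
      refine ⟨(hXF _).2 (X.add_mem ((hXF _).1 hb.1) (hSX s hs)), fun h => hb.2 ?_⟩
      simpa using Finset.add_mem_add h (hsym s hs)
    have c1 := Finset.card_le_card hBS
    have c2 := Finset.card_sdiff_of_subset hX0
    have c3 := Finset.card_sdiff_of_subset (hsubX _ hX0)
    have c4 := hne0.card_pos
    have c5 := Finset.card_le_card hX0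
    have n1 : (XF \ (A0 + S)).Nonempty := Finset.card_pos.1 (by omega)
    have l1 : ((XF \ (A0 + S)) + S).card < XF.card := by omega
    have k1 := hκ _ n1 Finset.sdiff_subset l1
    have k2 := hm _ n1 Finset.sdiff_subset l1 (by omega)
    omega
  have htr : ∀ a ∈ A0, ({-a} + A0) ⊆ XF ∧ ({-a} + A0).card = A0.card ∧
      (({-a} + A0) + S).card = A0.card + κ ∧ (0 : F) ∈ ({-a} + A0) := by
    intro a ha
    refine ⟨?_, ?_, ?_, ?_⟩
    · intro x hx
      obtain ⟨b, hb, s, hs, rfl⟩ := Finset.mem_add.1 hx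
      rw [Finset.mem_singleton] at hb
      subst hb
      exact (hXF _).2 (X.add_mem (X.neg_mem ((hXF _).1 (hX0 ha))) ((hXF _).1 (hX0 hs)))
    · exact Finset.card_singleton_add _ _
    · rw [add_assoc, Finset.card_singleton_add, hfr0]
    · have := Finset.add_mem_add (Finset.mem_singleton_self (-a)) ha
      simpa using this
  have heq : ∀ a ∈ A0, ∀ b ∈ A0, ({-a} + A0 : Finset F) = {-b} + A0 := by
    intro a ha b hb
    obtain ⟨p1, p2, p3, p4⟩ := htr a ha
    obtain ⟨q1, q2, q3, q4⟩ := htr b hb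
    exact atom_inter XF S κ hκ A0.card hm hN _ _ p1 q1 p2 q2 p3 q3 (by omega)
      ⟨0, Finset.mem_inter.2 ⟨p4, q4⟩⟩
  obtain ⟨a0, ha0⟩ := hne0
  obtain ⟨p1, p2, p3, p4⟩ := htr a0 ha0
  have hsub : ∀ x ∈ ({-a0} + A0 : Finset F), ∀ y ∈ ({-a0} + A0 : Finset F),
      x - y ∈ ({-a0} + A0 : Finset F) := by
    intro x hx y hy
    obtain ⟨c, hc, a, ha, rfl⟩ := Finset.mem_add.1 hx
    obtain ⟨c', hc', b, hb, rfl⟩ := Finset.mem_add.1 hy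
    rw [Finset.mem_singleton] at hc hc'
    subst hc hc'
    rw [heq a0 ha0 b hb]
    refine Finset.mem_add.2 ⟨-b, Finset.mem_singleton_self _, a, ha, by abel⟩
  generalize hH : ({-a0} + A0 : Finset F) = H at *
  have hneg : ∀ x ∈ H, -x ∈ H := fun x hx => by simpa using hsub 0 p4 x hx
  let HG : AddSubgroup F :=
    { carrier := H
      zero_mem' := p4
      add_mem' := fun {x y} hx hy => by simpa using hsub x hx (-y) (hneg y hy)
      neg_mem' := fun {x} hx => hneg x hx }
  have hκA := hκ A hAne hAX hAS
  have hSH : ¬ ∀ s ∈ S, s ∈ H := by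
    intro h
    have : X ≤ HG := by
      rw [← hcl, AddSubgroup.closure_le]
      exact fun s hs => h s hs
    have h2 : XF ⊆ H := fun x hx => this ((hXF x).1 hx)
    have := Finset.card_le_card h2
    omega
  push Not at hSH
  obtain ⟨s, hs, hsH⟩ := hSH
  have hdis : Disjoint H ({s} + H) := by
    rw [Finset.disjoint_left]
    intro x hx hx2
    obtain ⟨c, hc, a, ha, rfl⟩ := Finset.mem_add.1 hx2
    rw [Finset.mem_singleton] at hc
    subst hc
    exact hsH (by simpa using hsub _ hx _ ha)
  have hun : H ∪ ({s} + H) ⊆ H + S := by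
    apply Finset.union_subset
    · exact fun x hx => by simpa using Finset.add_mem_add hx h0
    · rw [add_comm]
      exact Finset.add_subset_add_left (by simpa using hs)
  have c1 := Finset.card_le_card hun
  rw [Finset.card_union_of_disjoint hdis, Finset.card_singleton_add] at c1
  have c2 : S.card ≤ (H + S).card :=
    Finset.card_le_card (fun x hx => by simpa using Finset.add_mem_add p4 hx)
  omega

/-- Petridis: a nonempty subset with controlled double sumset. -/
lemma petridis_two {F : Type} [AddCommGroup F] [DecidableEq F] (M D : Finset F)
    (hM : M.Nonempty) : ∃ Z ⊆ M, Z.Nonempty ∧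
      (Z + (D + D)).card * M.card ^ 2 ≤ (M + D).card ^ 2 * Z.card := by
  obtain ⟨Z, hZ, hmin⟩ := Finset.exists_min_image (M.powerset.erase ∅)
    (fun B => ((B + D).card : ℚ) / B.card)
    ⟨M, by simp [hM.ne_empty]⟩
  have hZ' : Z.Nonempty ∧ Z ⊆ M := by
    simpa [Finset.nonempty_iff_ne_empty] using hZ
  have key : ∀ B : Finset F, B.Nonempty → B ⊆ M →
      (Z + D).card * B.card ≤ (B + D).card * Z.card := by
    intro B h1 h2
    have := hmin B (by simp [h1.ne_empty, h2])
    have hb : (0 : ℚ) < B.card := by exact_mod_cast h1.card_pos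
    have hz : (0 : ℚ) < Z.card := by exact_mod_cast hZ'.1.card_pos
    rw [div_le_div_iff₀ hz hb] at this
    exact_mod_cast this
  have hp := Finset.pluennecke_petridis_inequality_add (A := Z) (B := D) D (by
    intro B hB
    rcases B.eq_empty_or_nonempty with rfl | h
    · simp
    · exact key B h (hB.trans hZ'.2))
  refine ⟨Z, hZ'.2, hZ'.1, ?_⟩
  have hk := key M hM subset_rfl
  have e : D + Z + D = Z + (D + D) := by rw [add_comm D Z, add_assoc]
  rw [e, add_comm D Z] at hp
  have hz := hZ'.1.card_pos
  have h1 : ((Z + (D + D)).card * M.card ^ 2) * Z.card ≤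
      ((M + D).card ^ 2 * Z.card) * Z.card := by
    calc ((Z + (D + D)).card * M.card ^ 2) * Z.card
        = ((Z + (D + D)).card * Z.card) * M.card ^ 2 := by ring
      _ ≤ ((Z + D).card * (Z + D).card) * M.card ^ 2 := by gcongr
      _ = ((Z + D).card * M.card) * ((Z + D).card * M.card) := by ring
      _ ≤ ((M + D).card * Z.card) * ((M + D).card * Z.card) := by gcongr
      _ = _ := by ring
  exact Nat.le_of_mul_le_mul_right h1 hz

/-- Even words: twice a symmetric generating set avoiding an index two subgroup generates it. -/
lemma closure_two {F : Type} [AddCommGroup F] (X : AddSubgroup F) (hX : X.index = 2)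
    (D : Set F) (hD : D ⊆ (X : Set F)ᶜ) (hne : D.Nonempty)
    (hcl : AddSubgroup.closure D = ⊤) : AddSubgroup.closure (D + D) = X := by
  apply le_antisymm
  · rw [AddSubgroup.closure_le]
    rintro _ ⟨a, ha, b, hb, rfl⟩
    exact (AddSubgroup.add_mem_iff_of_index_two hX).2 (by
      have := hD ha; have := hD hb; simp_all)
  · obtain ⟨e, he⟩ := hne
    have key : ∀ x : F, x ∈ AddSubgroup.closure D →
        x ∈ AddSubgroup.closure (D + D) ∨ x + e ∈ AddSubgroup.closure (D + D) := by
      have hde : ∀ a ∈ D, a + e ∈ AddSubgroup.closure (D + D) := fun a ha =>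
        AddSubgroup.subset_closure (Set.add_mem_add ha he)
      intro x hx
      induction hx using AddSubgroup.closure_induction with
      | mem a ha => exact Or.inr (hde a ha)
      | zero => exact Or.inl (zero_mem _)
      | add a b _ _ iha ihb =>
        rcases iha with h | h <;> rcases ihb with h' | h'
        · exact Or.inl (add_mem h h')
        · right; rw [add_assoc]; exact add_mem h h'
        · right
          have := add_mem h h'
          rwa [show a + e + b = a + b + e by abel] at this
        · left
          have := sub_mem (add_mem h h') (hde e he)
          rwa [show a + e + (b + e) - (e + e) = a + b by abel] at this
      | neg a _ iha =>
        rcases iha with h | h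
        · exact Or.inl (neg_mem h)
        · right
          have := sub_mem (hde e he) h
          rwa [show e + e - (a + e) = -a + e by abel] at this
    intro x hx
    rcases key x (hcl ▸ AddSubgroup.mem_top x) with h | h
    · exact h
    · exfalso
      have hle : AddSubgroup.closure (D + D) ≤ X := by
        rw [AddSubgroup.closure_le]
        rintro _ ⟨a, ha, b, hb, rfl⟩
        exact (AddSubgroup.add_mem_iff_of_index_two hX).2 (by
          have := hD ha; have := hD hb; simp_all)
      have := sub_mem (hle h) hx
      exact hD he (by simpa using this)

lemma core {F : Type} [AddCommGroup F] [Fintype F] [DecidableEq F] (n : ℕ)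
    (hF : Fintype.card F = 2 * n) (X : AddSubgroup F) (hX : X.index = 2)
    (D D' M : Finset F) (hD : (D : Set F) ⊆ (X : Set F)ᶜ) (hsym : ∀ x ∈ D, -x ∈ D)
    (hcl : AddSubgroup.closure (D : Set F) = ⊤) (hd : 16 ≤ D.card)
    (hdn : D.card ^ 3 ≤ n) (hD' : D' ⊆ D) (hsmall : 16 * (D.card - D'.card) ^ 2 ≤ D.card)
    (u : F) (hM : (M : Set F) ⊆ (X : Set F) ∨ (M : Set F) ⊆ (X : Set F)ᶜ)
    (hu : {u} + D' ⊆ M) (hMn : 2 * M.card ≤ n) :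
    6 * M.card + (D + D).card ≤ 6 * (M + D).card := by
  classical
  by_contra hcon
  push Not at hcon
  have hDne : D.Nonempty := Finset.card_pos.1 (by omega)
  -- the sumset with D'
  have s1 : D.card ≤ (D + D).card := Finset.card_le_card_add_right hDne
  have s2 : (D + D).card ≤ D.card * D.card := Finset.card_add_le
  have s3 : D + D ⊆ (D' + D) ∪ ((D \ D') + (D \ D')) := by
    intro x hx
    obtain ⟨a, ha, b, hb, rfl⟩ := Finset.mem_add.1 hx
    rw [Finset.mem_union]
    by_cases h1 : a ∈ D'
    · exact Or.inl (Finset.add_mem_add h1 hb)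
    · by_cases h2 : b ∈ D'
      · left; rw [add_comm a b]; exact Finset.add_mem_add h2 ha
      · right
        exact Finset.add_mem_add (Finset.mem_sdiff.2 ⟨ha, h1⟩) (Finset.mem_sdiff.2 ⟨hb, h2⟩)
  have s4 := (Finset.card_le_card s3).trans (Finset.card_union_le _ _)
  have s5 : ((D \ D') + (D \ D')).card ≤ (D.card - D'.card) ^ 2 := by
    rw [← Finset.card_sdiff_of_subset hD', sq]; exact Finset.card_add_le
  have s6 : (D' + D).card ≤ (M + D).card := by
    have := Finset.card_le_card (Finset.add_subset_add_right (t := D) hu)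
    rwa [add_assoc, Finset.card_singleton_add] at this
  have s7 : 15 * (D + D).card ≤ 16 * (M + D).card := by omega
  have hMpos : 0 < M.card := by omega
  obtain ⟨Z, hZM, hZ, hpet⟩ := petridis_two M D (Finset.card_pos.1 hMpos)
  have hZc := Finset.card_le_card hZM
  -- upper bound on Z + (D + D)
  have hup : 2 * (Z + (D + D)).card < 2 * Z.card + (D + D).card := by
    generalize (Z + (D + D)).card = p at *
    generalize (D + D).card = s at *
    generalize (M + D).card = q at *
    generalize M.card = m at *
    generalize Z.card = z at *
    by_contra hc
    push Not at hc
    have hc' : (2 * z + s : ℝ) ≤ 2 * p := by exact_mod_cast hc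
    have hpet' : (p : ℝ) * m ^ 2 ≤ q ^ 2 * z := by exact_mod_cast hpet
    have hcon' : (6 * q : ℝ) < 6 * m + s := by exact_mod_cast hcon
    have s7' : (15 * s : ℝ) ≤ 16 * q := by exact_mod_cast s7
    have hm : (0 : ℝ) < m := by exact_mod_cast hMpos
    have hz : (z : ℝ) ≤ m := by exact_mod_cast hZc
    have hz0 : (0 : ℝ) ≤ z := by positivity
    have hs0 : (0 : ℝ) < s := by
      have : 0 < s := by omega
      exact_mod_cast this
    have hms : (37 * s : ℝ) ≤ 48 * m := by linarith
    have hq0 : (0 : ℝ) ≤ q := by positivity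
    have hq2 : (q : ℝ) ^ 2 ≤ (m + s / 6) ^ 2 := by
      apply pow_le_pow_left₀ hq0; linarith
    have h1 : (z + s / 2 : ℝ) * m ^ 2 ≤ (m + s / 6) ^ 2 * z := by
      calc (z + s / 2 : ℝ) * m ^ 2 ≤ (p : ℝ) * (m : ℝ) ^ 2 := by
            apply mul_le_mul_of_nonneg_right _ (by positivity); linarith
        _ ≤ (q : ℝ) ^ 2 * (z : ℝ) := hpet'
        _ ≤ _ := mul_le_mul_of_nonneg_right hq2 hz0
    have h2 : (s / 2 : ℝ) * m ^ 2 ≤ (m * s / 3 + s ^ 2 / 36) * z := by nlinarith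
    have h3 : (m * s / 3 + s ^ 2 / 36) * z ≤ (m * s / 3 + s ^ 2 / 36 : ℝ) * m :=
      mul_le_mul_of_nonneg_left hz (by positivity)
    have h4 : (s * m : ℝ) * (m / 2) ≤ (s * m) * (m / 3 + s / 36) := by nlinarith
    have h5 := le_of_mul_le_mul_left h4 (by positivity)
    linarith
  -- lower bound by Olson
  let XF : Finset F := Finset.univ.filter (· ∈ X)
  have hXF : ∀ x, x ∈ XF ↔ x ∈ X := by intro x; simp [XF]
  have hXc : XF.card = n := by
    have h1 := X.card_mul_index
    rw [hX, Nat.card_eq_fintype_card, Nat.card_eq_fintype_card, hF] at h1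
    have h2 : Fintype.card X = XF.card := Fintype.card_of_subtype XF hXF
    omega
  obtain ⟨z0, hz0⟩ := hZ
  have hdiff : ∀ z ∈ Z, -z0 + z ∈ X := by
    intro z hz
    rw [AddSubgroup.add_mem_iff_of_index_two hX, X.neg_mem_iff]
    rcases hM with h | h
    · have a1 := h (hZM hz0); have a2 := h (hZM hz); simp_all
    · have a1 := h (hZM hz0); have a2 := h (hZM hz); simp_all
  have hlow := olson X XF (D + D) hXF
    (by
      obtain ⟨e, he⟩ := hDne
      simpa using Finset.add_mem_add he (hsym e he))
    (by
      intro x hx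
      obtain ⟨a, ha, b, hb, rfl⟩ := Finset.mem_add.1 hx
      rw [neg_add]
      exact Finset.add_mem_add (hsym a ha) (hsym b hb))
    (by
      rw [Finset.coe_add]
      exact closure_two X hX D hD (by exact_mod_cast hDne) hcl)
    ({-z0} + Z) ⟨-z0 + z0, Finset.add_mem_add (Finset.mem_singleton_self _) hz0⟩
    (by
      intro x hx
      obtain ⟨c, hc, a, ha, rfl⟩ := Finset.mem_add.1 hx
      rw [Finset.mem_singleton] at hc
      subst hc
      exact (hXF _).2 (hdiff a ha))
    (by
      rw [add_assoc, Finset.card_singleton_add, hXc]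
      have : 16 * (D.card * D.card) ≤ D.card ^ 3 := by
        rw [pow_succ, sq, mul_comm]; gcongr
      omega)
  rw [add_assoc, Finset.card_singleton_add, Finset.card_singleton_add] at hlow
  omega

theorem stmt14 :
    ∃ d₀ : ℕ, ∀ (n : ℕ) (F : Type) [AddCommGroup F] [Fintype F],
      Fintype.card F = 2 * n →
      ∀ X : AddSubgroup F, X.index = 2 →
        ∀ D : Set F, D ⊆ ((↑X : Set F))ᶜ → (∀ x ∈ D, -x ∈ D) →
          AddSubgroup.closure D = ⊤ →
          ∀ d : ℕ, D.ncard = d → d₀ ≤ d → (d : ℝ) ≤ (n : ℝ) ^ ((1 : ℝ) / 3) →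
            ∀ D' : Set F, D' ⊆ D → (d : ℝ) - Real.sqrt d / logb 2 d ≤ (D'.ncard : ℝ) →
              ∀ u : F, ∀ M : Set F,
                (M ⊆ (↑X : Set F) ∨ M ⊆ ((↑X : Set F))ᶜ) →
                {u} + D' ⊆ M → 2 * M.ncard ≤ n →
                (M.ncard : ℝ) + ((D + D).ncard : ℝ) / 6 ≤ ((M + D).ncard : ℝ) := by
  refine ⟨16, ?_⟩
  intro n F _ _ hF X hX D hD hsym hcl d hd hd0 hdn D' hD' hsmall u M hM hu hMn
  classical
  lift D to Finset F using D.toFinite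
  lift D' to Finset F using D'.toFinite
  lift M to Finset F using M.toFinite
  rw [← Finset.coe_add, ← Finset.coe_add]
  rw [Set.ncard_coe_finset] at *
  rw [Set.ncard_coe_finset, Set.ncard_coe_finset]
  subst hd
  have hD'2 : D' ⊆ D := by exact_mod_cast hD'
  have hcard := Finset.card_le_card hD'2
  have h3 : D.card ^ 3 ≤ n := by
    have h : ((D.card : ℝ)) ^ 3 ≤ ((n : ℝ) ^ ((1 : ℝ) / 3)) ^ 3 :=
      pow_le_pow_left₀ (by positivity) hdn 3
    rw [← Real.rpow_natCast ((n : ℝ) ^ ((1 : ℝ) / 3)), ← Real.rpow_mul (by positivity)] at h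
    norm_num at h
    exact_mod_cast h
  have hlog : (4 : ℝ) ≤ logb 2 D.card := by
    rw [Real.le_logb_iff_rpow_le (by norm_num) (by positivity)]
    norm_num
    exact hd0
  have h4 : 16 * (D.card - D'.card) ^ 2 ≤ D.card := by
    have h : ((D.card - D'.card : ℕ) : ℝ) ≤ Real.sqrt D.card / 4 := by
      rw [Nat.cast_sub hcard]
      have : Real.sqrt D.card / logb 2 D.card ≤ Real.sqrt D.card / 4 := by gcongr
      linarith
    have h' := pow_le_pow_left₀ (by positivity) h 2
    rw [div_pow, Real.sq_sqrt (by positivity)] at h'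
    have : (16 : ℝ) * ((D.card - D'.card : ℕ) : ℝ) ^ 2 ≤ D.card := by linarith
    exact_mod_cast this
  have hu' : {u} + D' ⊆ M := by
    rw [← Finset.coe_subset, Finset.coe_add, Finset.coe_singleton]; exact hu
  have := core n hF X hX D D' M hD (by exact_mod_cast hsym) hcl hd0 h3 hD'2 h4 u hM hu' hMn
  have h' : (6 * M.card + (D + D).card : ℝ) ≤ 6 * (M + D).card := by exact_mod_cast this
  linarith
end

section
/- Let Γ be a d-regular finite bipartite graph with parts X and Y, let A ⊆ X, let [A] = {u ∈ X : N(u) ⊆ N(A)} be its closure, let G = N(A), and let t = |G| − |[A]|. Let 0 < ψ < d and suppose (S, F) is a ψ-approximation for A. Then |S| ≤ |F| + 2tψ/(d − ψ). -/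
/-- The neighborhood of a set of vertices. -/
def nbhdOf {V : Type*} (G : SimpleGraph V) (A : Set V) : Set V :=
  {v | ∃ u ∈ A, G.Adj u v}

/-- The closure `[A] = {u ∈ X : N(u) ⊆ N(A)}` of `A ⊆ X` in a bipartite graph with part `X`. -/
def closureOf {V : Type*} (G : SimpleGraph V) (X A : Set V) : Set V :=
  {u ∈ X | G.neighborSet u ⊆ nbhdOf G A}

theorem aux_deg {V : Type*} [Fintype V] [DecidableEq V] (Γ : SimpleGraph V) [DecidableRel Γ.Adj]
    (u : V) (Q : Finset V) (Q' : Set V) (h : (Q : Set V) = Q') :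
    ∑ v ∈ Q, (if Γ.Adj u v then (1 : ℝ) else 0) = ((Γ.neighborSet u ∩ Q').ncard : ℝ) := by
  rw [Finset.sum_boole, ← Set.ncard_coe_finset]
  congr 2
  ext v
  subst h
  simp [and_comm]

theorem stmt15 {V : Type*} [Fintype V] (Γ : SimpleGraph V) (X Y : Set V)
    (hpart : X ∪ Y = Set.univ) (hdisj : Disjoint X Y)
    (hbip : ∀ u v : V, Γ.Adj u v → (u ∈ X ↔ v ∈ Y))
    (d : ℕ) (hreg : ∀ v : V, (Γ.neighborSet v).ncard = d)
    (A : Set V) (hA : A ⊆ X)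
    (ψ : ℝ) (hψ0 : 0 < ψ) (hψd : ψ < d)
    (S Fs : Set V)
    -- `(S, Fs)` is a `ψ`-approximation for `A`:
    (hS : closureOf Γ X A ⊆ S) (hF : Fs ⊆ nbhdOf Γ A)
    (hSdeg : ∀ u ∈ S, (d : ℝ) - ψ ≤ ((Γ.neighborSet u ∩ Fs).ncard : ℝ))
    (hFdeg : ∀ v ∈ Y \ Fs, (d : ℝ) - ψ ≤ ((Γ.neighborSet v ∩ (X \ S)).ncard : ℝ)) :
    (S.ncard : ℝ) ≤ (Fs.ncard : ℝ) +
      2 * (((nbhdOf Γ A).ncard : ℝ) - ((closureOf Γ X A).ncard : ℝ)) * ψ / ((d : ℝ) - ψ) := by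
  classical
  have hGY : nbhdOf Γ A ⊆ Y := by
    rintro v ⟨u, hu, huv⟩
    exact (hbip u v huv).1 (hA hu)
  have hdψ : 0 < (d : ℝ) - ψ := by linarith
  have hd : 0 < (d : ℝ) := by linarith
  have hSX : S ⊆ X := by
    intro u hu
    have h1 := hSdeg u hu
    have h2 : (Γ.neighborSet u ∩ Fs).Nonempty := by
      rw [Set.nonempty_iff_ne_empty]
      intro h
      rw [h] at h1
      simp at h1
      linarith
    obtain ⟨v, hv, hvF⟩ := h2
    exact (hbip u v hv).2 (hGY (hF hvF))
  set G := nbhdOf Γ A with hG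
  set C := closureOf Γ X A with hC
  have hCG : ∀ u ∈ C, ∀ v, Γ.Adj u v → v ∈ G := fun u hu v huv => hu.2 huv
  clear_value G C
  let w : V → V → ℝ := fun u v => if Γ.Adj u v then (1 : ℝ) else 0
  have hw0 : ∀ u v, 0 ≤ w u v := by
    intro u v
    simp only [w]
    split_ifs <;> norm_num
  have hws : ∀ u v, w u v = w v u := by
    intro u v
    simp only [w, Γ.adj_comm]
  have hdeg : ∀ u, ∑ v, w u v = d := by
    intro u
    have := aux_deg Γ u Finset.univ Set.univ (by simp)
    rw [Set.inter_univ, hreg] at this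
    exact this
  have hle : ∀ u (Q : Finset V), ∑ v ∈ Q, w u v ≤ d := by
    intro u Q
    rw [← hdeg u]
    exact Finset.sum_le_sum_of_subset_of_nonneg (Finset.subset_univ _) (fun _ _ _ => hw0 _ _)
  have hle2 : ∀ u (P Q : Finset V), Disjoint P Q → (d : ℝ) - ψ ≤ ∑ v ∈ P, w u v →
      ∑ v ∈ Q, w u v ≤ ψ := by
    intro u P Q hPQ h
    have := hle u (P ∪ Q)
    rw [Finset.sum_union hPQ] at this
    linarith
  have hsplit : ∀ u, (d : ℝ) = ∑ v ∈ Fs.toFinset, w u v + ∑ v ∈ G.toFinset \ Fs.toFinset, w u v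
      + ∑ v ∈ (G.toFinset)ᶜ, w u v := by
    intro u
    have h1 := Finset.sum_sdiff (f := w u) (Set.toFinset_subset_toFinset.2 hF)
    have h2 := Finset.sum_add_sum_compl G.toFinset (w u)
    rw [hdeg] at h2
    linarith
  have e1 : ∑ u ∈ S.toFinset, ∑ v ∈ Fs.toFinset, w u v ≤ d * (Fs.ncard : ℝ) := by
    rw [Finset.sum_comm]
    calc _ ≤ ∑ v ∈ Fs.toFinset, (d : ℝ) := Finset.sum_le_sum (fun v _ => by
            simp only [hws _ v]
            exact hle v _)
      _ = _ := by rw [Finset.sum_const, Set.ncard_eq_toFinset_card', nsmul_eq_mul, mul_comm]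
  have e2 : ∑ u ∈ S.toFinset, ∑ v ∈ G.toFinset \ Fs.toFinset, w u v
      ≤ ψ * ((G.ncard : ℝ) - Fs.ncard) := by
    rw [Finset.sum_comm]
    calc _ ≤ ∑ v ∈ G.toFinset \ Fs.toFinset, ψ := Finset.sum_le_sum (fun v hv => by
            simp only [hws _ v]
            have hv' : v ∈ G ∧ v ∉ Fs := by simpa using hv
            refine hle2 v (X \ S).toFinset _ ?_ ?_
            · rw [Set.disjoint_toFinset]
              exact Set.disjoint_sdiff_left
            · have := aux_deg Γ v (X \ S).toFinset (X \ S) (by simp)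
              exact (hFdeg v ⟨hGY hv'.1, hv'.2⟩).trans this.ge)
      _ = _ := by
        rw [Finset.sum_const, nsmul_eq_mul, Finset.cast_card_sdiff (Set.toFinset_subset_toFinset.2 hF),
          Set.ncard_eq_toFinset_card', Set.ncard_eq_toFinset_card', mul_comm]
  have e3 : ∑ u ∈ S.toFinset, ∑ v ∈ (G.toFinset)ᶜ, w u v
      ≤ ψ * ((S.ncard : ℝ) - C.ncard) := by
    rw [← Finset.sum_sdiff (Set.toFinset_subset_toFinset.2 hS)]
    have z : ∑ u ∈ C.toFinset, ∑ v ∈ (G.toFinset)ᶜ, w u v = 0 := by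
      refine Finset.sum_eq_zero (fun u hu => Finset.sum_eq_zero (fun v hv => ?_))
      simp only [w]
      rw [if_neg]
      intro huv
      have := hCG u (by simpa using hu) v huv
      simp [this] at hv
    rw [z, add_zero]
    calc _ ≤ ∑ u ∈ S.toFinset \ C.toFinset, ψ := Finset.sum_le_sum (fun u hu => by
            have hu' : u ∈ S ∧ u ∉ C := by simpa using hu
            refine hle2 u Fs.toFinset _ ?_ ?_
            · exact Finset.disjoint_of_subset_left (Set.toFinset_subset_toFinset.2 hF)
                disjoint_compl_right
            · have := aux_deg Γ u Fs.toFinset Fs (by simp)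
              exact (hSdeg u hu'.1).trans this.ge)
      _ = _ := by
        rw [Finset.sum_const, nsmul_eq_mul, Finset.cast_card_sdiff (Set.toFinset_subset_toFinset.2 hS),
          Set.ncard_eq_toFinset_card', Set.ncard_eq_toFinset_card', mul_comm]
  have e0 : (d : ℝ) * S.ncard = ∑ u ∈ S.toFinset, ∑ v ∈ Fs.toFinset, w u v
      + ∑ u ∈ S.toFinset, ∑ v ∈ G.toFinset \ Fs.toFinset, w u v
      + ∑ u ∈ S.toFinset, ∑ v ∈ (G.toFinset)ᶜ, w u v := by
    rw [← Finset.sum_add_distrib, ← Finset.sum_add_distrib, Set.ncard_eq_toFinset_card',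
      mul_comm, ← nsmul_eq_mul, ← Finset.sum_const]
    exact Finset.sum_congr rfl (fun u _ => hsplit u)
  have ht : (C.ncard : ℝ) ≤ G.ncard := by
    have h1 : ∑ u ∈ C.toFinset, ∑ v ∈ G.toFinset, w u v = C.ncard * d := by
      rw [Set.ncard_eq_toFinset_card', ← nsmul_eq_mul, ← Finset.sum_const]
      refine Finset.sum_congr rfl (fun u hu => ?_)
      rw [← hdeg u]
      refine Finset.sum_subset (Finset.subset_univ _) (fun v _ hv => ?_)
      simp only [w]
      rw [if_neg]
      intro huv
      exact hv (by simpa using hCG u (by simpa using hu) v huv)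
    have h2 : ∑ u ∈ C.toFinset, ∑ v ∈ G.toFinset, w u v ≤ G.ncard * d := by
      rw [Finset.sum_comm, Set.ncard_eq_toFinset_card', ← nsmul_eq_mul, ← Finset.sum_const]
      refine Finset.sum_le_sum (fun v _ => ?_)
      simp only [hws _ v]
      exact hle v _
    rw [h1] at h2
    exact le_of_mul_le_mul_right h2 hd
  rw [← sub_le_iff_le_add', le_div_iff₀ hdψ]
  have h3 : 0 ≤ ((G.ncard : ℝ) - C.ncard) * ψ := mul_nonneg (by linarith) hψ0.le
  nlinarith
end

section
/- There exist absolute constants C, K₁, K₂ > 0 with the following property. Let F be a finite abelian group of order 2n, X a subgroup of F of index 2 with coset Y = F \ X, and D ⊆ Y a generating set of F with D = −D, |D| = d, such that d ≥ C · (log d)^8 · (log n), d ≤ n^{1/3}, and d₂ := |2D| ≥ d · (log d)^3. Then for all integers a, g with t = g − a and every set C₀ ⊆ Y with |C₀| ≤ K₁ · t · d₂ / (log d)^3, there exists a family 𝒞₂ of subsets of Y with |𝒞₂| ≤ 2^{K₂ · t / log d} such that for every small 2-linked set A ⊆ X with |[A]| = a and |N(A)| = g whose boundary G' is contained in C₀,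 some F₀ ∈ 𝒞₂ is a φ-approximation for A, where φ = d − √d / log d. -/
open Pointwise Real

/-- The closure `[A] = {u ∈ X : N(u) ⊆ N(A)}` for the bipartite Cayley graph with parts
`X`, `Y` and generator set `D ⊆ Y`; here `N(S) = S + D`. -/
def closureSet {F : Type*} [AddCommGroup F] (D X A : Set F) : Set F :=
  {u ∈ X | {u} + D ⊆ A + D}

/-- The square graph of the Cayley graph with generator set `D`:
`u ~ v` iff `u ≠ v` and `N(u) ∩ N(v) ≠ ∅`. -/
def squareGraph {F : Type*} [AddCommGroup F] (D : Set F) : SimpleGraph F :=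
  SimpleGraph.fromRel (fun u v => (({u} + D) ∩ ({v} + D)).Nonempty)

/-- `A` is 2-linked if it is connected in the square graph. -/
def TwoLinked {F : Type*} [AddCommGroup F] (D A : Set F) : Prop :=
  ((squareGraph D).induce A).Connected

/-- The boundary `G' = {v ∈ N(A) : N(v) ∩ [A]ᶜ ≠ ∅}` of `G = N(A)`. -/
def boundarySet {F : Type*} [AddCommGroup F] (D X A : Set F) : Set F :=
  {v ∈ A + D | ¬ ({v} + D ⊆ closureSet D X A)}

/-- `F₀ ⊆ G` is a `φ`-approximation for `A` if `F₀ ⊇ G_φ` and `N(F₀) ⊇ [A]`, where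
`G_φ` is the set of vertices of `G = N(A)` with at least `φ` neighbors in `[A]`. -/
def IsPhiApprox {F : Type*} [AddCommGroup F] (D X A : Set F) (φ : ℝ) (F₀ : Set F) : Prop :=
  F₀ ⊆ A + D ∧
  {v ∈ A + D | φ ≤ ((({v} + D) ∩ closureSet D X A).ncard : ℝ)} ⊆ F₀ ∧
  closureSet D X A ⊆ F₀ + D

section Iso
variable {F : Type*} [AddCommGroup F] [Fintype F] [DecidableEq F]

lemma iso_min (XF E : Finset F) (X : AddSubgroup F) (hX : ∀ x, x ∈ XF ↔ x ∈ X)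
    (hE0 : (0 : F) ∈ E) (hsym : ∀ x ∈ E, -x ∈ E)
    (hgen : AddSubgroup.closure (E : Set F) = X) (W : Finset F) (hW : W.Nonempty)
    (hWX : W ⊆ XF) (hne : W + E ≠ XF) : E.card + 2 * W.card ≤ 2 * (W + E).card := by
  classical
  let P : Finset F → Prop := fun W => W.Nonempty ∧ W ⊆ XF ∧ W + E ≠ XF
  have hEX : ∀ e ∈ E, e ∈ X := fun e he => hgen ▸ AddSubgroup.subset_closure he
  have haddX : ∀ W : Finset F, W ⊆ XF → W + E ⊆ XF := by
    intro W hW x hx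
    obtain ⟨w, hw, e, he, rfl⟩ := Finset.mem_add.1 hx
    exact (hX _).2 (X.add_mem ((hX _).1 (hW hw)) (hEX e he))
  have hsubE : ∀ W : Finset F, W ⊆ W + E := by
    intro W x hx
    exact Finset.mem_add.2 ⟨x, hx, 0, hE0, add_zero x⟩
  obtain ⟨B, hB, hBmin⟩ := Finset.exists_min_image (Finset.univ.filter P)
    (fun W => (W + E).card - W.card) ⟨W, by simp [P, hW, hWX, hne]⟩
  obtain ⟨A, hA, hAmin⟩ := Finset.exists_min_image
    ((Finset.univ.filter P).filter (fun W => (W + E).card - W.card = (B + E).card - B.card))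
    (fun W => W.card) ⟨B, by simpa using hB⟩
  simp only [Finset.mem_filter, Finset.mem_univ, true_and] at hB hBmin hA hAmin
  obtain ⟨⟨hAne, hAX, hAE⟩, hAB⟩ := hA
  have hmin : ∀ W, P W → (A + E).card + W.card ≤ (W + E).card + A.card := by
    intro W hW
    have h1 := hBmin W hW
    have h2 := Finset.card_le_card (hsubE W)
    have h3 := Finset.card_le_card (hsubE A)
    omega
  have hatom : ∀ W, P W → (W + E).card + A.card ≤ (A + E).card + W.card → A.card ≤ W.card := by
    intro W hW h
    have h1 := hBmin W hW
    have h2 := Finset.card_le_card (hsubE W)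
    have h3 := Finset.card_le_card (hsubE A)
    exact hAmin W ⟨hW, by omega⟩
  -- the dual fragment
  have hdual : A.card + (A + E).card ≤ XF.card := by
    let V := XF \ (A + E)
    have hVne : V.Nonempty := by
      rw [Finset.sdiff_nonempty]
      intro h
      exact hAE (Finset.Subset.antisymm (haddX A hAX) h)
    have hVX : V ⊆ XF := Finset.sdiff_subset
    have hdisj : V + E ⊆ XF \ A := by
      intro x hx
      rw [Finset.mem_sdiff]
      refine ⟨haddX V hVX hx, fun hxA => ?_⟩
      obtain ⟨v, hv, e, he, rfl⟩ := Finset.mem_add.1 hx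
      have := (Finset.mem_sdiff.1 hv).2
      exact this (Finset.mem_add.2 ⟨v + e, hxA, -e, hsym e he, by abel⟩)
    have hPV : P V := by
      refine ⟨hVne, hVX, fun h => ?_⟩
      obtain ⟨x, hx⟩ := hAne
      have h1 : x ∈ V + E := by rw [h]; exact hAX hx
      exact (Finset.mem_sdiff.1 (hdisj h1)).2 hx
    have c1 := Finset.card_le_card hdisj
    rw [Finset.card_sdiff_of_subset hAX] at c1
    have c2 : V.card = XF.card - (A + E).card := Finset.card_sdiff_of_subset (haddX A hAX)
    have c3 := Finset.card_le_card (haddX A hAX)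
    have c4 := Finset.card_le_card hAX
    have := hatom V hPV (by omega)
    omega
  have key : ∀ x ∈ X, (A ∩ ({x} + A)).Nonempty → {x} + A = A := by
    intro x hx hinter
    let A' := {x} + A
    have hA'c : A'.card = A.card := by
      simp only [A', Finset.singleton_add]; exact Finset.card_vadd_finset x A
    have hA'Ec : (A' + E).card = (A + E).card := by
      rw [show A' + E = {x} + (A + E) from add_assoc _ _ _, Finset.singleton_add]
      exact Finset.card_vadd_finset x (A + E)
    have hA'X : A' ⊆ XF := by
      intro y hy
      obtain ⟨z, hz, w, hw, rfl⟩ := Finset.mem_add.1 hy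
      rw [Finset.mem_singleton.1 hz]
      exact (hX _).2 (X.add_mem hx ((hX _).1 (hAX hw)))
    have hPI : P (A ∩ A') := by
      refine ⟨hinter, fun y hy => hAX (Finset.mem_inter.1 hy).1, fun h => ?_⟩
      apply hAE
      apply Finset.Subset.antisymm (haddX A hAX)
      rw [← h]
      exact Finset.add_subset_add_right Finset.inter_subset_left
    have h1 := hmin _ hPI
    have hsubm : ((A ∪ A') + E).card + ((A ∩ A') + E).card ≤ (A + E).card + (A' + E).card := by
      rw [← Finset.card_union_add_card_inter (A + E) (A' + E)]
      apply Nat.add_le_add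
      · rw [Finset.union_add]
      · exact Finset.card_le_card Finset.inter_add_subset
    have hui := Finset.card_union_add_card_inter A A'
    have hip : 0 < (A ∩ A').card := Finset.card_pos.2 hinter
    have hUX : A ∪ A' ⊆ XF := Finset.union_subset hAX hA'X
    have hPU : P (A ∪ A') := by
      refine ⟨hinter.mono (fun y hy => Finset.mem_union_left _ (Finset.mem_inter.1 hy).1), hUX,
        fun h => ?_⟩
      rw [h] at hsubm
      omega
    have h2 := hmin _ hPU
    have h3 := hatom _ hPI (by omega)
    have h4 : A ∩ A' = A := Finset.eq_of_subset_of_card_le Finset.inter_subset_left h3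
    have h5 : A ∩ A' = A' := Finset.eq_of_subset_of_card_le Finset.inter_subset_right (by omega)
    exact h5.symm.trans h4
  have key2 : ∀ a ∈ A, ∀ b ∈ A, ∀ c ∈ A, b - a + c ∈ A := by
    intro a ha b hb c hc
    have := key (b - a) (X.sub_mem ((hX _).1 (hAX hb)) ((hX _).1 (hAX ha)))
      ⟨b, Finset.mem_inter.2 ⟨hb, Finset.mem_add.2 ⟨b - a, by simp, a, ha, by abel⟩⟩⟩
    rw [← this]
    exact Finset.mem_add.2 ⟨b - a, by simp, c, hc, rfl⟩
  obtain ⟨a0, ha0⟩ := hAne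
  obtain ⟨e, he, hea⟩ : ∃ e ∈ E, a0 + e ∉ A := by
    by_contra! hcon
    have hall : ∀ x ∈ X, a0 + x ∈ A := by
      intro x hx
      rw [← hgen] at hx
      induction hx using AddSubgroup.closure_induction with
      | mem x hx => exact hcon x hx
      | zero => simpa using ha0
      | add x y _ _ hx hy =>
        have := key2 a0 ha0 _ hx _ hy
        convert this using 1; abel
      | neg x _ hx =>
        have := key2 _ hx a0 ha0 a0 ha0
        convert this using 1; abel
    apply hAE
    apply Finset.Subset.antisymm (haddX A hAX)
    intro y hy
    apply hsubE
    have := hall (y - a0) (X.sub_mem ((hX _).1 hy) ((hX _).1 (hAX ha0)))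
    simpa using this
  have hdj : Disjoint A ({e} + A) := by
    rw [Finset.disjoint_iff_inter_eq_empty]
    by_contra h
    have := key e (hEX e he) (Finset.nonempty_iff_ne_empty.2 h)
    apply hea
    rw [← this]
    exact Finset.mem_add.2 ⟨e, by simp, a0, ha0, by abel⟩
  have h2A : A.card + A.card ≤ (A + E).card := by
    have : A ∪ ({e} + A) ⊆ A + E := by
      apply Finset.union_subset (hsubE A)
      rw [add_comm]
      exact Finset.add_subset_add_left (by simpa using he)
    have h := Finset.card_le_card this
    rw [Finset.card_union_of_disjoint hdj, Finset.singleton_add] at h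
    have h' : (e +ᵥ A).card = A.card := Finset.card_vadd_finset e A
    omega
  have hEA : E.card ≤ (A + E).card := Finset.card_le_card_add_left ⟨a0, ha0⟩
  have := hmin W ⟨hW, hWX, hne⟩
  omega

end Iso

section Hit
variable {F : Type*} [DecidableEq F]

lemma hitting (G₀ : Finset F) (hm : G₀.Nonempty) (O : F → Finset F) (w : F → ℝ)
    (hw : ∀ z, 0 ≤ w z) (δ : ℝ) (hδ1 : δ ≤ 1) (k : ℕ) : ∀ I : Finset F,
    (∀ i ∈ I, δ * G₀.card ≤ ((O i ∩ G₀).card : ℝ)) →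
    ∃ T ⊆ G₀, T.card ≤ k ∧
      ((I.filter (fun i => Disjoint (O i) T)).card : ℝ) + ∑ z ∈ T, w z ≤
        (1 - δ) ^ k * I.card + k * ((∑ z ∈ G₀, w z) / G₀.card) := by
  have hmpos : (0 : ℝ) < G₀.card := by exact_mod_cast Finset.card_pos.2 hm
  induction k with
  | zero =>
    intro I hI
    refine ⟨∅, by simp, by simp, by simp⟩
  | succ k ih =>
    intro I hI
    let Iz : F → Finset F := fun z => I.filter (fun i => z ∉ O i)
    have hcount : ∑ z ∈ G₀, ((Iz z).card : ℝ) ≤ (1 - δ) * I.card * G₀.card := by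
      have h1 : ∑ z ∈ G₀, ((Iz z).card : ℝ) = ∑ i ∈ I, ((G₀.filter (fun z => z ∉ O i)).card : ℝ) := by
        simp only [Iz, Finset.card_filter, Nat.cast_sum]
        exact Finset.sum_comm
      rw [h1]
      have h2 : ∀ i ∈ I, ((G₀.filter (fun z => z ∉ O i)).card : ℝ) ≤ (1 - δ) * G₀.card := by
        intro i hi
        have h3 := hI i hi
        have h4 : (G₀.filter (fun z => z ∉ O i)).card + (O i ∩ G₀).card = G₀.card := by
          rw [add_comm, ← Finset.card_filter_add_card_filter_not (s := G₀) (fun z => z ∈ O i)]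
          congr 2
          ext z; simp [and_comm]
        have h5 : ((G₀.filter (fun z => z ∉ O i)).card : ℝ) + (O i ∩ G₀).card = G₀.card := by
          exact_mod_cast h4
        linarith
      calc _ ≤ ∑ i ∈ I, (1 - δ) * (G₀.card : ℝ) := Finset.sum_le_sum h2
        _ = _ := by rw [Finset.sum_const, nsmul_eq_mul]; ring
    have hr : 0 ≤ (1 - δ) ^ k := pow_nonneg (by linarith) k
    obtain ⟨z, hz, hzle⟩ := Finset.exists_le_of_sum_le hm
      (f := fun z => (1 - δ) ^ k * ((Iz z).card : ℝ) + w z)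
      (g := fun _ => (1 - δ) ^ (k + 1) * I.card + (∑ z ∈ G₀, w z) / G₀.card) (by
        rw [Finset.sum_add_distrib, ← Finset.mul_sum, Finset.sum_const, nsmul_eq_mul]
        have := mul_le_mul_of_nonneg_left hcount hr
        have e : (G₀.card : ℝ) * ((1 - δ) ^ (k + 1) * I.card + (∑ z ∈ G₀, w z) / G₀.card)
          = (1 - δ) ^ k * ((1 - δ) * I.card * G₀.card) + ∑ z ∈ G₀, w z := by
            field_simp
            ring
        rw [e]; linarith)
    obtain ⟨T, hTG, hTc, hT⟩ := ih (Iz z) (fun i hi => hI i (Finset.mem_filter.1 hi).1)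
    refine ⟨insert z T, Finset.insert_subset hz hTG, (Finset.card_insert_le z T).trans (by omega), ?_⟩
    have e1 : I.filter (fun i => Disjoint (O i) (insert z T)) =
        (Iz z).filter (fun i => Disjoint (O i) T) := by
      ext i
      simp only [Iz, Finset.mem_filter, Finset.disjoint_insert_right, and_assoc]
    have e2 : ∑ y ∈ insert z T, w y ≤ w z + ∑ y ∈ T, w y := by
      by_cases hzT : z ∈ T
      · rw [Finset.insert_eq_of_mem hzT]; linarith [hw z]
      · rw [Finset.sum_insert hzT]
    rw [e1]
    push_cast
    linarith

lemma count_small (M : Finset F) (s x : ℝ) (hx : 0 < x) (hx1 : x ≤ 1) :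
    ((M.powerset.filter (fun T => (T.card : ℝ) ≤ s)).card : ℝ) * x ^ s ≤ (1 + x) ^ M.card := by
  have h1 : ∑ T ∈ M.powerset, x ^ T.card = (1 + x) ^ M.card := by
    have := Finset.prod_one_add (f := fun _ : F => x) M
    simpa using this.symm
  rw [← h1]
  calc _ = ∑ T ∈ M.powerset.filter (fun T => (T.card : ℝ) ≤ s), x ^ s := by
        rw [Finset.sum_const, nsmul_eq_mul]
    _ ≤ ∑ T ∈ M.powerset.filter (fun T => (T.card : ℝ) ≤ s), x ^ T.card := by
        apply Finset.sum_le_sum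
        intro T hT
        rw [← Real.rpow_natCast]
        exact Real.rpow_le_rpow_of_exponent_ge hx hx1 (Finset.mem_filter.1 hT).2
    _ ≤ _ := Finset.sum_le_sum_of_subset_of_nonneg (Finset.filter_subset _ _)
        (fun _ _ _ => by positivity)

end Hit

section Sel
variable {F : Type*} [DecidableEq F]

lemma select (G₀ : Finset F) (O : F → Finset F) (w : F → ℝ) (hw : ∀ z, 0 ≤ w z)
    (I : Finset F) (d d₂ L t : ℝ) (hL : 2 ≤ L) (hd : L ^ 6 ≤ d) (hd2 : d * L ^ 3 ≤ d₂)
    (ht : 0 ≤ t) (hG₀ : (G₀.card : ℝ) ≤ t * d₂ / L ^ 3) (hI : (I.card : ℝ) ≤ 2 * t * d ^ 3)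
    (hO : ∀ i ∈ I, d₂ ≤ 2 * ((O i ∩ G₀).card : ℝ)) (hwt : ∑ z ∈ G₀, w z ≤ t * d)
    (hexp : Real.exp (-(4 * L)) ≤ 1 / d ^ 4) :
    ∃ T ⊆ G₀, (T.card : ℝ) ≤ 9 * t / L ^ 2 ∧
      ((I.filter (fun i => Disjoint (O i) T)).card : ℝ) + ∑ z ∈ T, w z ≤ 11 * t / L ^ 2 := by
  have hLpos : 0 < L := by linarith
  have hdL : L ^ 2 ≤ d := le_trans (pow_le_pow_right₀ (by linarith) (by norm_num)) hd
  have hdpos : 0 < d := lt_of_lt_of_le (by positivity) hd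
  have hd2pos : 0 < d₂ := lt_of_lt_of_le (by positivity) hd2
  rcases I.eq_empty_or_nonempty with rfl | ⟨i, hi⟩
  · exact ⟨∅, by simp, by simp; positivity, by simp; positivity⟩
  have hm : d₂ / 2 ≤ G₀.card := by
    have h1 := hO i hi
    have h2 : ((O i ∩ G₀).card : ℝ) ≤ G₀.card := by
      exact_mod_cast Finset.card_le_card Finset.inter_subset_right
    linarith
  have hmpos : (0 : ℝ) < G₀.card := by linarith
  have hne : G₀.Nonempty := Finset.card_pos.1 (by exact_mod_cast hmpos)
  set m : ℝ := (G₀.card : ℝ) with hmdef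
  let k := ⌈8 * L * m / d₂⌉₊
  have hk1 : 8 * L * m / d₂ ≤ k := Nat.le_ceil _
  have hk2 : (k : ℝ) ≤ 9 * L * m / d₂ := by
    have h1 : (k : ℝ) < 8 * L * m / d₂ + 1 := Nat.ceil_lt_add_one (by positivity)
    have h2 : 1 ≤ L * m / d₂ := by
      rw [le_div_iff₀ hd2pos]; nlinarith
    have : 9 * L * m / d₂ = 8 * L * m / d₂ + L * m / d₂ := by ring
    linarith
  have hδ1 : d₂ / (2 * m) ≤ 1 := by rw [div_le_one (by positivity)]; linarith
  obtain ⟨T, hT, hTk, hTm⟩ := hitting G₀ hne O w hw (d₂ / (2 * m)) hδ1 k I (by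
    intro i hi
    have := hO i hi
    have e : d₂ / (2 * m) * m = d₂ / 2 := by field_simp
    rw [← hmdef, e]; linarith)
  have hmm : L * m / d₂ ≤ t / L ^ 2 := by
    rw [div_le_div_iff₀ hd2pos (by positivity)]
    rw [le_div_iff₀ (by positivity)] at hG₀
    nlinarith
  refine ⟨T, hT, ?_, hTm.trans ?_⟩
  · have : (T.card : ℝ) ≤ k := by exact_mod_cast hTk
    calc (T.card : ℝ) ≤ 9 * L * m / d₂ := this.trans hk2
      _ = 9 * (L * m / d₂) := by ring
      _ ≤ 9 * (t / L ^ 2) := by linarith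
      _ = _ := by ring
  · have h1 : (1 - d₂ / (2 * m)) ^ k ≤ 1 / d ^ 4 := by
      refine le_trans ?_ hexp
      calc (1 - d₂ / (2 * m)) ^ k ≤ (Real.exp (-(d₂ / (2 * m)))) ^ k := by
            apply pow_le_pow_left₀ (by linarith)
            have := Real.add_one_le_exp (-(d₂ / (2 * m))); linarith
        _ = Real.exp (-(k * (d₂ / (2 * m)))) := by
            rw [← Real.exp_nat_mul]; ring_nf
        _ ≤ _ := by
            apply Real.exp_le_exp.2
            have : 8 * L * m / d₂ * (d₂ / (2 * m)) ≤ k * (d₂ / (2 * m)) :=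
              mul_le_mul_of_nonneg_right hk1 (by positivity)
            have e : 8 * L * m / d₂ * (d₂ / (2 * m)) = 4 * L := by field_simp; norm_num
            linarith
    have h2 : (1 - d₂ / (2 * m)) ^ k * I.card ≤ 2 * (t / L ^ 2) := by
      calc _ ≤ 1 / d ^ 4 * (2 * t * d ^ 3) := by
            apply mul_le_mul h1 hI (by positivity) (by positivity)
        _ = 2 * (t / d) := by field_simp
        _ ≤ _ := by gcongr
    have h3 : k * ((∑ z ∈ G₀, w z) / m) ≤ 9 * (t / L ^ 2) := by
      calc _ ≤ 9 * L * m / d₂ * (t * d / m) := by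
            apply mul_le_mul hk2 (by gcongr)
              (div_nonneg (Finset.sum_nonneg fun z _ => hw z) hmpos.le) (by positivity)
        _ = 9 * (L * t * d / d₂) := by field_simp
        _ ≤ _ := by
            gcongr 9 * ?_
            rw [div_le_div_iff₀ hd2pos (by positivity)]
            nlinarith
    have e : 11 * t / L ^ 2 = 2 * (t / L ^ 2) + 9 * (t / L ^ 2) := by ring
    rw [e]; linarith

end Sel

/-- Linking relation: `u`, `u'` have a common neighbour outside `C₀`. -/
def lnk {F : Type*} [AddCommGroup F] (D C₀ : Finset F) (u u' : F) : Prop :=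
  ∃ y, y ∉ C₀ ∧ y - u ∈ D ∧ y - u' ∈ D

/-- Saturation of a set under `lnk`. -/
def sat {F : Type*} [AddCommGroup F] (D C₀ : Finset F) (S : Set F) : Set F :=
  {u | ∃ s ∈ S, Relation.ReflTransGen (lnk D C₀) s u}

section Core
variable {F : Type*} [AddCommGroup F]

lemma lnk_symm (D C₀ : Finset F) {u v : F} (h : lnk D C₀ u v) : lnk D C₀ v u := by
  obtain ⟨y, h1, h2, h3⟩ := h
  exact ⟨y, h1, h3, h2⟩

lemma rt_symm (D C₀ : Finset F) {u v : F} (h : Relation.ReflTransGen (lnk D C₀) u v) :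
    Relation.ReflTransGen (lnk D C₀) v u := by
  induction h with
  | refl => exact .refl
  | tail _ h ih => exact (Relation.ReflTransGen.single (lnk_symm D C₀ h)).trans ih

lemma sat_mono (D C₀ : Finset F) {S S' : Set F} (h : S ⊆ S') : sat D C₀ S ⊆ sat D C₀ S' := by
  rintro u ⟨s, hs, h'⟩
  exact ⟨s, h hs, h'⟩

lemma sat_self (D C₀ : Finset F) (S : Set F) : S ⊆ sat D C₀ S := fun u hu => ⟨u, hu, .refl⟩

lemma sat_sub (D C₀ B G : Finset F) (hG : ∀ y, y ∈ G ↔ ∃ u ∈ B, y - u ∈ D)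
    (hcl : ∀ y ∈ G, y ∉ C₀ → ∀ u, y - u ∈ D → u ∈ B) (S : Set F) (hS : ∀ u ∈ S, u ∈ B) :
    ∀ u ∈ sat D C₀ S, u ∈ B := by
  rintro u ⟨s, hs, h⟩
  induction h with
  | refl => exact hS s hs
  | tail _ h ih =>
    obtain ⟨y, h1, h2, h3⟩ := h
    exact hcl y ((hG y).2 ⟨_, ih, h2⟩) h1 _ h3

variable [DecidableEq F]

lemma gen2 (X : AddSubgroup F) (hX : X.index = 2) (D : Finset F) (hDX : ∀ x ∈ D, x ∉ X)
    (hgen : AddSubgroup.closure (D : Set F) = ⊤) (hDne : D.Nonempty) :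
    AddSubgroup.closure ((D + D : Finset F) : Set F) = X := by
  apply le_antisymm
  · rw [AddSubgroup.closure_le]
    intro x hx
    obtain ⟨a, ha, b, hb, rfl⟩ := Finset.mem_add.1 hx
    exact (AddSubgroup.add_mem_iff_of_index_two hX).2 (iff_of_false (hDX a ha) (hDX b hb))
  · obtain ⟨e, he⟩ := hDne
    set K := AddSubgroup.closure ((D + D : Finset F) : Set F) with hK
    have hKX : K ≤ X := by
      rw [hK, AddSubgroup.closure_le]
      intro x hx
      obtain ⟨a, ha, b, hb, rfl⟩ := Finset.mem_add.1 hx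
      exact (AddSubgroup.add_mem_iff_of_index_two hX).2 (iff_of_false (hDX a ha) (hDX b hb))
    have hsub : ∀ a ∈ D, ∀ b ∈ D, a + b ∈ K := fun a ha b hb =>
      AddSubgroup.subset_closure (by exact_mod_cast Finset.add_mem_add ha hb)
    have claim : ∀ x ∈ AddSubgroup.closure (D : Set F), x ∈ K ∨ x + e ∈ K := by
      intro x hx
      induction hx using AddSubgroup.closure_induction with
      | mem x hx => exact Or.inr (hsub x hx e he)
      | zero => exact Or.inl K.zero_mem
      | add x y _ _ hx hy =>
        rcases hx with hx | hx <;> rcases hy with hy | hy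
        · exact Or.inl (K.add_mem hx hy)
        · right; rw [add_assoc]; exact K.add_mem hx hy
        · right
          have := K.add_mem hx hy
          convert this using 1; abel
        · left
          have := K.sub_mem (K.add_mem hx hy) (hsub e he e he)
          convert this using 1; abel
      | neg x _ hx =>
        rcases hx with hx | hx
        · exact Or.inl (K.neg_mem hx)
        · right
          have := K.sub_mem (hsub e he e he) hx
          convert this using 1; abel
    intro x hx
    rcases claim x (by rw [hgen]; trivial) with h | h
    · exact h
    · exact absurd ((X.add_mem_cancel_left hx).1 (hKX h)) (hDX e he)

open Classical in
/-- The part of `C₀` adjacent to the saturation of `R`. -/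
noncomputable def obs (D C₀ : Finset F) (R : Set F) : Finset F :=
  C₀.filter (fun z => ∃ u ∈ sat D C₀ R, z - u ∈ D)

lemma obs_mono (D C₀ : Finset F) {S S' : Set F} (h : S ⊆ S') : obs D C₀ S ⊆ obs D C₀ S' := by
  intro z hz
  simp only [obs, Finset.mem_filter] at hz ⊢
  obtain ⟨h1, u, hu, h2⟩ := hz
  exact ⟨h1, u, sat_mono D C₀ h hu, h2⟩

variable [Fintype F]

lemma class_size (X : AddSubgroup F) (hX : X.index = 2) (D C₀ B G : Finset F)
    (hDX : ∀ x ∈ D, x ∉ X) (hDs : ∀ x ∈ D, -x ∈ D)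
    (hgen : AddSubgroup.closure (D : Set F) = ⊤)
    (hBX : ∀ u ∈ B, u ∈ X) (hG : ∀ y, y ∈ G ↔ ∃ u ∈ B, y - u ∈ D)
    (hcl : ∀ y ∈ G, y ∉ C₀ → ∀ u, y - u ∈ D → u ∈ B) (hGY : ∃ y, y ∉ X ∧ y ∉ G)
    (u : F) (hu : u ∈ B) (y0 : F) (hy0 : y0 - u ∈ D) (hy0C : y0 ∉ C₀) :
    (D + D).card ≤ 2 * (obs D C₀ {u}).card := by
  classical
  have hDne : D.Nonempty := ⟨_, hy0⟩
  let W : Finset F := Finset.univ.filter (fun y => y ∉ C₀ ∧ ∃ u' ∈ sat D C₀ {u}, y - u' ∈ D)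
  have hsat := sat_sub D C₀ B G hG hcl {u} (by simpa using hu)
  have hstep : ∀ y ∈ W, ∀ e ∈ D, y + e ∈ sat D C₀ {u} := by
    intro y hy e he
    obtain ⟨h1, u', ⟨s, hs, h2⟩, h3⟩ := (Finset.mem_filter.1 hy).2
    exact ⟨s, hs, h2.tail ⟨y, h1, h3, by simpa using hDs e he⟩⟩
  have hsub : W + (D + D) ⊆ W ∪ obs D C₀ {u} := by
    intro z hz
    obtain ⟨y, hy, f, hf, rfl⟩ := Finset.mem_add.1 hz
    obtain ⟨e1, he1, e2, he2, rfl⟩ := Finset.mem_add.1 hf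
    have h1 := hstep y hy e1 he1
    have h2 : y + (e1 + e2) - (y + e1) ∈ D := by convert he2 using 1; abel
    rw [Finset.mem_union]
    by_cases hc : y + (e1 + e2) ∈ C₀
    · right; simp only [obs, Finset.mem_filter]; exact ⟨hc, _, h1, h2⟩
    · left; simp only [W, Finset.mem_filter, Finset.mem_univ, true_and]; exact ⟨hc, _, h1, h2⟩
  have hsubG : ∀ z ∈ W + (D + D), z ∈ G := by
    intro z hz
    obtain ⟨y, hy, f, hf, rfl⟩ := Finset.mem_add.1 hz
    obtain ⟨e1, he1, e2, he2, rfl⟩ := Finset.mem_add.1 hf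
    exact (hG _).2 ⟨_, hsat _ (hstep y hy e1 he1), by convert he2 using 1; abel⟩
  have hy0W : y0 ∈ W := by
    simp only [W, Finset.mem_filter, Finset.mem_univ, true_and]
    exact ⟨hy0C, u, sat_self _ _ _ rfl, hy0⟩
  have hGnX : ∀ z ∈ G, z ∉ X := by
    intro z hz hzX
    obtain ⟨v, hv, h⟩ := (hG z).1 hz
    exact hDX _ h (X.sub_mem hzX (hBX v hv))
  have hWG : ∀ z ∈ W, z ∈ G := by
    intro z hz
    obtain ⟨h1, u', h2, h3⟩ := (Finset.mem_filter.1 hz).2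
    exact (hG z).2 ⟨u', hsat _ h2, h3⟩
  have hdiff : ∀ a b : F, a ∉ X → b ∉ X → -a + b ∈ X := by
    intro a b ha hb
    exact (AddSubgroup.add_mem_iff_of_index_two hX).2 (iff_of_false (by simpa using ha) hb)
  have hiso := iso_min (Finset.univ.filter (fun x => x ∈ X)) (D + D) X (by simp)
    (Finset.mem_add.2 ⟨_, hy0, _, hDs _ hy0, by abel⟩)
    (by
      intro x hx
      obtain ⟨e1, he1, e2, he2, rfl⟩ := Finset.mem_add.1 hx
      exact Finset.mem_add.2 ⟨-e1, hDs _ he1, -e2, hDs _ he2, by abel⟩)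
    (gen2 X hX D hDX hgen hDne) ({-y0} + W) ⟨0, Finset.mem_add.2 ⟨-y0, by simp, y0, hy0W, by abel⟩⟩
    (by
      intro x hx
      obtain ⟨a, ha, b, hb, rfl⟩ := Finset.mem_add.1 hx
      rw [Finset.mem_singleton.1 ha]
      simp only [Finset.mem_filter, Finset.mem_univ, true_and]
      exact hdiff _ _ (hGnX _ (hWG _ hy0W)) (hGnX _ (hWG _ hb)))
    (by
      intro h
      obtain ⟨y, hyX, hyG⟩ := hGY
      have h1 : -y0 + y ∈ ({-y0} + W) + (D + D) := by
        rw [h]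
        simp only [Finset.mem_filter, Finset.mem_univ, true_and]
        exact hdiff _ _ (hGnX _ (hWG _ hy0W)) hyX
      rw [add_assoc] at h1
      obtain ⟨a, ha, b, hb, hab⟩ := Finset.mem_add.1 h1
      rw [Finset.mem_singleton.1 ha] at hab
      rw [add_left_cancel hab] at hb
      exact hyG (hsubG y hb))
  have c1 : ({-y0} + W).card = W.card := by
    rw [Finset.singleton_add]; exact Finset.card_vadd_finset _ _
  have c2 : (({-y0} + W) + (D + D)).card = (W + (D + D)).card := by
    rw [add_assoc, Finset.singleton_add]; exact Finset.card_vadd_finset _ _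
  have c3 := (Finset.card_le_card hsub).trans (Finset.card_union_le _ _)
  omega

lemma phi_size (X : AddSubgroup F) (hX : X.index = 2) (D C₀ B G : Finset F)
    (hDX : ∀ x ∈ D, x ∉ X) (hDs : ∀ x ∈ D, -x ∈ D)
    (hgen : AddSubgroup.closure (D : Set F) = ⊤)
    (hBX : ∀ u ∈ B, u ∈ X) (hG : ∀ y, y ∈ G ↔ ∃ u ∈ B, y - u ∈ D)
    (hcl : ∀ y ∈ G, y ∉ C₀ → ∀ u, y - u ∈ D → u ∈ B) (hGY : ∃ y, y ∉ X ∧ y ∉ G)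
    (v : F) (hv : 2 * (Finset.univ.filter (fun u => v - u ∈ D ∧ u ∉ B)).card ^ 2 ≤ (D + D).card) :
    (D + D).card ≤ 2 * (obs D C₀ {u | u ∈ B ∧ v - u ∈ D}).card := by
  classical
  by_cases hex : ∃ u ∈ B, v - u ∈ D ∧ ∃ y, y - u ∈ D ∧ y ∉ C₀
  · obtain ⟨u, hu, hvu, y, hy, hyC⟩ := hex
    refine (class_size X hX D C₀ B G hDX hDs hgen hBX hG hcl hGY u hu y hy hyC).trans ?_
    have := Finset.card_le_card (obs_mono D C₀ (S := {u}) (S' := {u | u ∈ B ∧ v - u ∈ D})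
      (by simp [hu, hvu]))
    omega
  · push Not at hex
    let D' := D.filter (fun x => v + x ∈ B)
    let D'' := D.filter (fun x => v + x ∉ B)
    have h1 : D + D ⊆ (D' + D) ∪ (D'' + D'') := by
      intro z hz
      obtain ⟨e1, he1, e2, he2, rfl⟩ := Finset.mem_add.1 hz
      rw [Finset.mem_union]
      by_cases h1 : v + e1 ∈ B
      · exact Or.inl (Finset.add_mem_add (by simp [D', he1, h1]) he2)
      by_cases h2 : v + e2 ∈ B
      · left; rw [add_comm e1 e2]; exact (Finset.add_mem_add (by simp [D', he2, h2]) he1)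
      · exact Or.inr (Finset.add_mem_add (by simp [D'', he1, h1]) (by simp [D'', he2, h2]))
    have h2 : D''.card ≤ (Finset.univ.filter (fun u => v - u ∈ D ∧ u ∉ B)).card := by
      apply Finset.card_le_card_of_injOn (fun x => v + x)
      · intro x hx
        have hx := Finset.mem_filter.1 (Finset.mem_coe.1 hx)
        simp only [Finset.coe_filter, Finset.mem_univ, true_and, Set.mem_ofPred_eq]
        exact ⟨by simpa using hDs _ hx.1, hx.2⟩
      · intro a _ b _ h; exact add_left_cancel h
    have h3 : (D' + D).card ≤ (obs D C₀ {u | u ∈ B ∧ v - u ∈ D}).card := by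
      apply Finset.card_le_card_of_injOn (fun x => v + x)
      · intro x hx
        obtain ⟨e1, he1, e2, he2, rfl⟩ := Finset.mem_add.1 (Finset.mem_coe.1 hx)
        have he1 := Finset.mem_filter.1 he1
        have hv1 : v - (v + e1) ∈ D := by simpa using hDs _ he1.1
        have hz : v + (e1 + e2) - (v + e1) ∈ D := by convert he2 using 1; abel
        simp only [obs, Finset.coe_filter, Set.mem_ofPred_eq]
        exact ⟨hex _ he1.2 hv1 _ hz, _, sat_self _ _ _ ⟨he1.2, hv1⟩, hz⟩
      · intro a _ b _ h; exact add_left_cancel h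
    have h4 := (Finset.card_le_card h1).trans (Finset.card_union_le _ _)
    have h5 : (D'' + D'').card ≤ D''.card * D''.card := Finset.card_add_le
    have h6 := Nat.mul_le_mul h2 h2
    rw [← pow_two, ← pow_two] at h6
    rw [← pow_two] at h5
    omega

lemma card_nbr (D : Finset F) (z : F) :
    (Finset.univ.filter (fun u => z - u ∈ D)).card = D.card := by
  have : Finset.univ.filter (fun u => z - u ∈ D) = D.image (fun x => z - x) := by
    ext u
    simp only [Finset.mem_filter, Finset.mem_univ, true_and, Finset.mem_image]
    constructor
    · intro h; exact ⟨_, h, by abel⟩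
    · rintro ⟨x, hx, rfl⟩; simpa using hx
  rw [this, Finset.card_image_of_injective]
  intro a b h; exact sub_right_injective h

lemma card_nbr' (D : Finset F) (u : F) :
    (Finset.univ.filter (fun y => y - u ∈ D)).card = D.card := by
  have : Finset.univ.filter (fun y => y - u ∈ D) = D.image (fun x => x + u) := by
    ext y
    simp only [Finset.mem_filter, Finset.mem_univ, true_and, Finset.mem_image]
    constructor
    · intro h; exact ⟨_, h, by abel⟩
    · rintro ⟨x, hx, rfl⟩; simpa using hx
  rw [this, Finset.card_image_of_injective]
  intro a b h; exact add_right_cancel h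

lemma nbr_split (D B : Finset F) (z : F) :
    (B.filter (fun u => z - u ∈ D)).card +
      (Finset.univ.filter (fun u => z - u ∈ D ∧ u ∉ B)).card = D.card := by
  rw [← card_nbr D z, ← Finset.card_filter_add_card_filter_not
    (s := Finset.univ.filter (fun u => z - u ∈ D)) (fun u => u ∈ B), Finset.filter_filter,
    Finset.filter_filter]
  congr 2
  ext u; simp [and_comm]

lemma edges (D B G : Finset F) (hG : ∀ y, y ∈ G ↔ ∃ u ∈ B, y - u ∈ D) :
    ∑ z ∈ G, ((Finset.univ.filter (fun u => z - u ∈ D ∧ u ∉ B)).card : ℝ) =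
      ((G.card : ℝ) - B.card) * D.card := by
  have h1 : ∑ z ∈ G, ((B.filter (fun u => z - u ∈ D)).card : ℝ) = B.card * D.card := by
    simp only [Finset.card_filter, Nat.cast_sum]
    rw [Finset.sum_comm]
    have : ∀ u ∈ B, ∑ z ∈ G, (((if z - u ∈ D then 1 else 0 : ℕ)) : ℝ) = D.card := by
      intro u hu
      rw [← Nat.cast_sum, ← Finset.card_filter, ← card_nbr' D u]
      congr 2
      ext y
      simp only [Finset.mem_filter, Finset.mem_univ, true_and, and_iff_right_iff_imp]
      intro h; exact (hG y).2 ⟨u, hu, h⟩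
    rw [Finset.sum_congr rfl this, Finset.sum_const, nsmul_eq_mul]
  have h2 : ∀ z ∈ G, ((Finset.univ.filter (fun u => z - u ∈ D ∧ u ∉ B)).card : ℝ) =
      D.card - ((B.filter (fun u => z - u ∈ D)).card : ℝ) := by
    intro z _
    have : ((B.filter (fun u => z - u ∈ D)).card : ℝ) +
      (Finset.univ.filter (fun u => z - u ∈ D ∧ u ∉ B)).card = D.card := by
      exact_mod_cast nbr_split D B z
    linarith
  rw [Finset.sum_congr rfl h2, Finset.sum_sub_distrib, h1, Finset.sum_const, nsmul_eq_mul]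
  ring

lemma packing (D B1 Low : Finset F) (h : ∀ u ∈ B1, ∀ y, y - u ∈ D → y ∈ Low)
    (hDne : D.Nonempty) :
    ∃ B' ⊆ B1, B'.card * D.card ≤ Low.card ∧
      ∀ u ∈ B1, ∃ u' ∈ B', ∃ y, y - u ∈ D ∧ y - u' ∈ D := by
  classical
  let N : F → Finset F := fun u => Finset.univ.filter (fun y => y - u ∈ D)
  obtain ⟨B', hB', hmax⟩ := Finset.exists_max_image
    (B1.powerset.filter (fun S : Finset F => (S : Set F).PairwiseDisjoint N)) Finset.card
    ⟨∅, by simp⟩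
  simp only [Finset.mem_filter, Finset.mem_powerset] at hB' hmax
  refine ⟨B', hB'.1, ?_, ?_⟩
  · have h1 : (B'.biUnion N).card = B'.card * D.card := by
      rw [Finset.card_biUnion (fun a ha b hb hab => hB'.2 ha hb hab)]
      simp only [N, card_nbr', Finset.sum_const, smul_eq_mul]
    rw [← h1]
    apply Finset.card_le_card
    intro y hy
    obtain ⟨u, hu, hy⟩ := Finset.mem_biUnion.1 hy
    exact h u (hB'.1 hu) y (Finset.mem_filter.1 hy).2
  · intro u hu
    by_contra! hcon
    have huB' : u ∉ B' := by
      intro hu'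
      obtain ⟨e, he⟩ := hDne
      exact hcon u hu' (e + u) (by simpa using he) (by simpa using he)
    have := hmax (insert u B') ⟨Finset.insert_subset hu hB'.1, by
      rw [Finset.coe_insert, Set.pairwiseDisjoint_insert]
      refine ⟨hB'.2, fun u' hu' _ => ?_⟩
      rw [Finset.disjoint_left]
      intro y hy hy'
      exact hcon u' hu' y (Finset.mem_filter.1 hy).2 (Finset.mem_filter.1 hy').2⟩
    rw [Finset.card_insert_of_notMem huB'] at this
    omega

end Core

section Main
variable {F : Type*} [AddCommGroup F] [DecidableEq F] [Fintype F]

open Classical in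
/-- Neighbourhood of a finset. -/
noncomputable def nbr (D S : Finset F) : Finset F :=
  Finset.univ.filter (fun u => ∃ z ∈ S, z - u ∈ D)

lemma card_nbr_le (D S : Finset F) : (nbr D S).card ≤ S.card * D.card := by
  classical
  have : nbr D S ⊆ S - D := by
    intro u hu
    obtain ⟨z, hz, h⟩ := (Finset.mem_filter.1 hu).2
    exact Finset.mem_sub.2 ⟨z, hz, z - u, h, by abel⟩
  exact (Finset.card_le_card this).trans Finset.card_sub_le

/-- The candidate seed set determined by three small sets. -/
def seed (D T Q P : Finset F) : Set F :=
  {u | ((∃ z ∈ T, z - u ∈ D) ∧ u ∉ Q) ∨ u ∈ P}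

/-- The candidate approximation. -/
def cand (D C₀ T Q P : Finset F) : Set F :=
  {z | ∃ u ∈ sat D C₀ (seed D T Q P), z - u ∈ D}

set_option maxHeartbeats 2000000 in
lemma core_s17 (X : AddSubgroup F) (hX : X.index = 2) (D C₀ B G : Finset F)
    (hDX : ∀ x ∈ D, x ∉ X) (hDs : ∀ x ∈ D, -x ∈ D)
    (hgen : AddSubgroup.closure (D : Set F) = ⊤) (hCX : ∀ x ∈ C₀, x ∉ X)
    (hBX : ∀ u ∈ B, u ∈ X) (hG : ∀ y, y ∈ G ↔ ∃ u ∈ B, y - u ∈ D)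
    (hcl : ∀ y ∈ G, y ∉ C₀ → ∀ u, y - u ∈ D → u ∈ B) (hGY : ∃ y, y ∉ X ∧ y ∉ G)
    (L t d d₂ : ℝ) (hddef : d = (D.card : ℝ)) (hd₂def : d₂ = ((D + D).card : ℝ))
    (hL : 2 ≤ L) (hd : L ^ 6 ≤ d) (hd2 : d * L ^ 3 ≤ d₂) (ht : t = (G.card : ℝ) - B.card) (ht0 : 0 ≤ t)
    (hC₀ : (C₀.card : ℝ) ≤ t * d₂ / L ^ 3)
    (hexp : Real.exp (-(4 * L)) ≤ 1 / d ^ 4) :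
    ∃ T ⊆ C₀, ∃ Q ⊆ nbr D C₀, ∃ P ⊆ nbr D C₀,
      (T.card : ℝ) ≤ 12 * t / L ^ 2 ∧ (Q.card : ℝ) ≤ 12 * t / L ^ 2 ∧
      (P.card : ℝ) ≤ 12 * t / L ^ 2 ∧
      (∀ z ∈ cand D C₀ T Q P, z ∈ G) ∧
      (∀ v ∈ G, d - Real.sqrt d / L ≤ ((B.filter (fun u => v - u ∈ D)).card : ℝ) →
        v ∈ cand D C₀ T Q P) ∧
      ∀ u ∈ B, ∃ z ∈ cand D C₀ T Q P, z - u ∈ D := by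
  classical
  have hLpos : 0 < L := by linarith
  have hdpos : 0 < d := lt_of_lt_of_le (by positivity) hd
  have hd1 : 1 ≤ d := le_trans (one_le_pow₀ (by linarith)) hd
  have hd2pos : 0 < d₂ := lt_of_lt_of_le (by positivity) hd2
  have hDne : D.Nonempty := Finset.card_pos.1 (by rw [hddef] at hdpos; exact_mod_cast hdpos)
  have hsq : Real.sqrt d ^ 2 = d := Real.sq_sqrt hdpos.le
  have hsqpos : 0 < Real.sqrt d := Real.sqrt_pos.2 hdpos
  have hsqL : L ^ 3 ≤ Real.sqrt d := by
    apply Real.le_sqrt_of_sq_le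
    calc (L ^ 3) ^ 2 = L ^ 6 := by ring
      _ ≤ d := hd
  set η : ℝ := Real.sqrt d / L with hη
  have hηpos : 0 < η := by positivity
  have hd2le : d₂ ≤ d ^ 2 := by
    have : (D + D).card ≤ D.card * D.card := Finset.card_add_le
    rw [pow_two, hddef, hd₂def]; exact_mod_cast this
  have hC₀' : (C₀.card : ℝ) ≤ t * d ^ 2 := by
    refine hC₀.trans ?_
    rw [div_le_iff₀ (by positivity)]
    have h1 : 1 ≤ L ^ 3 := one_le_pow₀ (by linarith)
    calc t * d₂ ≤ t * d ^ 2 := by gcongr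
      _ ≤ t * d ^ 2 * L ^ 3 := le_mul_of_one_le_right (by positivity) h1
  -- weights
  let w : F → ℝ := fun z => ((Finset.univ.filter (fun u => z - u ∈ D ∧ u ∉ B)).card : ℝ)
  have hw0 : ∀ z, 0 ≤ w z := fun z => Nat.cast_nonneg _
  have hwsum : ∑ z ∈ G, w z = t * d := by rw [ht, hddef]; exact edges D B G hG
  have hwd : ∀ z, ((B.filter (fun u => z - u ∈ D)).card : ℝ) + w z = d := by
    intro z
    rw [hddef]
    simp only [w]
    exact_mod_cast nbr_split D B z
  have hφ : ∀ v, d - η ≤ ((B.filter (fun u => v - u ∈ D)).card : ℝ) →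
      (D + D).card ≤ 2 * (obs D C₀ {u | u ∈ B ∧ v - u ∈ D}).card := by
    intro v hv
    apply phi_size X hX D C₀ B G hDX hDs hgen hBX hG hcl hGY v
    have h1 : w v ≤ η := by linarith [hwd v]
    have h2 : 2 * (w v) ^ 2 ≤ d₂ := by
      have h3 : (w v) ^ 2 ≤ η ^ 2 := pow_le_pow_left₀ (hw0 v) h1 2
      have h4 : η ^ 2 = d / L ^ 2 := by rw [hη, div_pow, hsq]
      have h5 : 2 * (d / L ^ 2) ≤ d * L ^ 3 := by
        rw [← mul_div_assoc, div_le_iff₀ (by positivity)]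
        have : (2 : ℝ) ^ 5 ≤ L ^ 5 := pow_le_pow_left₀ (by norm_num) hL 5
        have : d * L ^ 3 * L ^ 2 = d * L ^ 5 := by ring
        nlinarith
      linarith
    have h3 : ((2 * (Finset.univ.filter (fun u => v - u ∈ D ∧ u ∉ B)).card ^ 2 : ℕ) : ℝ) ≤
        ((D + D).card : ℝ) := by rw [← hd₂def]; push_cast; exact h2
    exact_mod_cast h3
  -- selection
  let G₀ : Finset F := C₀.filter (fun z => z ∈ G)
  let I₁ : Finset F := B.filter (fun u => u ∈ nbr D C₀ ∧ ∃ y, y - u ∈ D ∧ y ∉ C₀)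
  let I₂ : Finset F := C₀.filter (fun v => v ∈ G ∧
    d - η ≤ ((B.filter (fun u => v - u ∈ D)).card : ℝ))
  let R : F → Set F := fun x => if x ∈ X then {x} else {u | u ∈ B ∧ x - u ∈ D}
  have hRB : ∀ x ∈ I₁ ∪ I₂, ∀ u ∈ R x, u ∈ B := by
    intro x hx u hu
    by_cases hxX : x ∈ X
    · have hxI : x ∈ I₁ := by
        rcases Finset.mem_union.1 hx with h | h
        · exact h
        · exact absurd hxX (hCX x (Finset.mem_filter.1 h).1)
      simp only [R, if_pos hxX, Set.mem_singleton_iff] at hu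
      rw [hu]; exact (Finset.mem_filter.1 hxI).1
    · simp only [R, if_neg hxX] at hu
      exact hu.1
  have hobsG : ∀ x ∈ I₁ ∪ I₂, obs D C₀ (R x) ⊆ G₀ := by
    intro x hx z hz
    simp only [obs, Finset.mem_filter] at hz
    obtain ⟨h1, u, hu, h2⟩ := hz
    exact Finset.mem_filter.2 ⟨h1, (hG z).2 ⟨u, sat_sub D C₀ B G hG hcl _ (hRB x hx) u hu, h2⟩⟩
  have hobs : ∀ x ∈ I₁ ∪ I₂, (D + D).card ≤ 2 * (obs D C₀ (R x)).card := by
    intro x hx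
    by_cases hxX : x ∈ X
    · have hxI : x ∈ I₁ := by
        rcases Finset.mem_union.1 hx with h | h
        · exact h
        · exact absurd hxX (hCX x (Finset.mem_filter.1 h).1)
      obtain ⟨hxB, _, y, hy, hyC⟩ := Finset.mem_filter.1 hxI
      simp only [R, if_pos hxX]
      exact class_size X hX D C₀ B G hDX hDs hgen hBX hG hcl hGY x hxB y hy hyC
    · have hxI : x ∈ I₂ := by
        rcases Finset.mem_union.1 hx with h | h
        · exact absurd (hBX x (Finset.mem_filter.1 h).1) hxX
        · exact h
      simp only [R, if_neg hxX]
      exact hφ x (Finset.mem_filter.1 hxI).2.2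
  have hNC : ((nbr D C₀).card : ℝ) ≤ t * d ^ 3 := by
    calc ((nbr D C₀).card : ℝ) ≤ C₀.card * d := by rw [hddef]; exact_mod_cast card_nbr_le D C₀
      _ ≤ t * d ^ 2 * d := by gcongr
      _ = _ := by ring
  have hIcard : ((I₁ ∪ I₂).card : ℝ) ≤ 2 * t * d ^ 3 := by
    have h1 : I₁.card ≤ (nbr D C₀).card :=
      Finset.card_le_card (fun x hx => (Finset.mem_filter.1 hx).2.1)
    have h2 : I₂.card ≤ C₀.card := Finset.card_filter_le _ _
    have h3 : ((I₁ ∪ I₂).card : ℝ) ≤ (nbr D C₀).card + C₀.card := by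
      have := Finset.card_union_le I₁ I₂
      exact_mod_cast this.trans (by omega)
    have h4 : t * d ^ 2 ≤ t * d ^ 3 := by
      have : d ^ 2 ≤ d ^ 3 := pow_le_pow_right₀ hd1 (by norm_num)
      gcongr
    linarith
  obtain ⟨T, hTG, hTc, hTm⟩ := select G₀ (fun x => obs D C₀ (R x)) w hw0 (I₁ ∪ I₂) d d₂ L t hL hd
    hd2 ht0 (le_trans (by exact_mod_cast Finset.card_filter_le _ _) hC₀) hIcard
    (by
      intro i hi
      rw [Finset.inter_eq_left.2 (hobsG i hi)]
      rw [hd₂def]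
      exact_mod_cast hobs i hi)
    (by
      rw [← hwsum]
      exact Finset.sum_le_sum_of_subset_of_nonneg
        (fun z hz => (Finset.mem_filter.1 hz).2) (fun z _ _ => hw0 z)) hexp
  set Miss := (I₁ ∪ I₂).filter (fun i => Disjoint (obs D C₀ (R i)) T) with hMiss
  have hTC : T ⊆ C₀ := hTG.trans (Finset.filter_subset _ _)
  have hsumT0 : 0 ≤ ∑ z ∈ T, w z := Finset.sum_nonneg fun z _ => hw0 z
  have hTL0 : 0 ≤ t / L ^ 2 := by positivity
  have e9 : 9 * t / L ^ 2 = 9 * (t / L ^ 2) := by ring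
  have e11 : 11 * t / L ^ 2 = 11 * (t / L ^ 2) := by ring
  have e12 : 12 * t / L ^ 2 = 12 * (t / L ^ 2) := by ring
  rw [e9] at hTc
  rw [e11] at hTm
  have hMiss0 : (0 : ℝ) ≤ Miss.card := Nat.cast_nonneg _
  let Q : Finset F := (nbr D T).filter (fun u => u ∉ B)
  have hQc : (Q.card : ℝ) ≤ ∑ z ∈ T, w z := by
    have h1 : Q ⊆ T.biUnion (fun z => Finset.univ.filter (fun u => z - u ∈ D ∧ u ∉ B)) := by
      intro u hu
      obtain ⟨h1, h2⟩ := Finset.mem_filter.1 hu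
      obtain ⟨z, hz, h3⟩ := (Finset.mem_filter.1 h1).2
      exact Finset.mem_biUnion.2 ⟨z, hz, by simp [h3, h2]⟩
    have h2 := (Finset.card_le_card h1).trans Finset.card_biUnion_le
    have h3 : (Q.card : ℝ) ≤ ((∑ z ∈ T, (Finset.univ.filter (fun u => z - u ∈ D ∧ u ∉ B)).card : ℕ) : ℝ) :=
      Nat.cast_le.2 h2
    rw [Nat.cast_sum] at h3
    exact h3
  have hnbrmono : nbr D T ⊆ nbr D C₀ := by
    intro u hu
    obtain ⟨z, hz, h⟩ := (Finset.mem_filter.1 hu).2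
    exact Finset.mem_filter.2 ⟨Finset.mem_univ _, z, hTC hz, h⟩
  -- low vertices
  let Low : Finset F := G.filter (fun v => ((B.filter (fun u => v - u ∈ D)).card : ℝ) < d - η)
  have hLow : (Low.card : ℝ) * η ≤ t * d := by
    rw [← hwsum]
    calc (Low.card : ℝ) * η = ∑ z ∈ Low, η := by rw [Finset.sum_const, nsmul_eq_mul]
      _ ≤ ∑ z ∈ Low, w z := by
          apply Finset.sum_le_sum
          intro z hz
          have := (Finset.mem_filter.1 hz).2
          linarith [hwd z]
      _ ≤ _ := Finset.sum_le_sum_of_subset_of_nonneg (Finset.filter_subset _ _)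
          (fun z _ _ => hw0 z)
  have hLowC : ∀ v ∈ Low, v ∈ C₀ := by
    intro v hv
    obtain ⟨h1, h2⟩ := Finset.mem_filter.1 hv
    by_contra hvC
    have : w v = 0 := by
      simp only [w, Nat.cast_eq_zero, Finset.card_eq_zero, Finset.filter_eq_empty_iff]
      intro u _ hu
      exact hu.2 (hcl v h1 hvC u hu.1)
    linarith [hwd v]
  let B1 : Finset F := B.filter (fun u => ∀ y, y - u ∈ D → y ∈ Low)
  obtain ⟨B', hB'B1, hB'c, hB'cov⟩ := packing D B1 Low
    (fun u hu => (Finset.mem_filter.1 hu).2) hDne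
  have hB'c2 : (B'.card : ℝ) ≤ t / L ^ 2 := by
    have h1 : (B'.card : ℝ) * d ≤ Low.card := by rw [hddef]; exact_mod_cast hB'c
    have h2 : (B'.card : ℝ) * d * η ≤ t * d := (mul_le_mul_of_nonneg_right h1 hηpos.le).trans hLow
    have h3 : (B'.card : ℝ) * η ≤ t := by
      have : (B'.card : ℝ) * η * d ≤ t * d := by linarith
      exact le_of_mul_le_mul_right this hdpos
    rw [le_div_iff₀ (by positivity)]
    refine le_trans ?_ h3
    apply mul_le_mul_of_nonneg_left _ (Nat.cast_nonneg _)
    rw [hη, le_div_iff₀ hLpos]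
    calc L ^ 2 * L = L ^ 3 := by ring
      _ ≤ _ := hsqL
  have hnbex : ∀ v : F, ∃ u, v ∈ G → u ∈ B ∧ v - u ∈ D := by
    intro v
    by_cases h : v ∈ G
    · obtain ⟨u, hu, h'⟩ := (hG v).1 h
      exact ⟨u, fun _ => ⟨hu, h'⟩⟩
    · exact ⟨0, fun h' => absurd h' h⟩
  choose nb hnb using hnbex
  let rep : F → F := fun x => if x ∈ X then x else nb x
  let P : Finset F := Miss.image rep ∪ B'
  have hPB : ∀ u ∈ P, u ∈ B ∧ u ∈ nbr D C₀ := by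
    intro u hu
    rcases Finset.mem_union.1 hu with h | h
    · obtain ⟨x, hx, rfl⟩ := Finset.mem_image.1 h
      have hx' := (Finset.mem_filter.1 hx).1
      by_cases hxX : x ∈ X
      · simp only [rep, if_pos hxX]
        rcases Finset.mem_union.1 hx' with h | h
        · exact ⟨(Finset.mem_filter.1 h).1, (Finset.mem_filter.1 h).2.1⟩
        · exact absurd hxX (hCX x (Finset.mem_filter.1 h).1)
      · simp only [rep, if_neg hxX]
        rcases Finset.mem_union.1 hx' with h | h
        · exact absurd (hBX x (Finset.mem_filter.1 h).1) hxX
        · obtain ⟨h1, h2, _⟩ := Finset.mem_filter.1 h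
          exact ⟨(hnb x h2).1, Finset.mem_filter.2 ⟨Finset.mem_univ _, x, h1, (hnb x h2).2⟩⟩
    · obtain ⟨h1, h2⟩ := Finset.mem_filter.1 (hB'B1 h)
      obtain ⟨e, he⟩ := hDne
      have h3 : (e + u) - u ∈ D := by simpa using he
      exact ⟨h1, Finset.mem_filter.2 ⟨Finset.mem_univ _, e + u, hLowC _ (h2 _ h3), h3⟩⟩
  have hPc : (P.card : ℝ) ≤ 12 * (t / L ^ 2) := by
    have h1 : P.card ≤ Miss.card + B'.card :=
      (Finset.card_union_le _ _).trans (Nat.add_le_add_right Finset.card_image_le _)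
    have h2 : (P.card : ℝ) ≤ Miss.card + B'.card := by exact_mod_cast h1
    linarith
  set S := seed D T Q P with hS
  have hSB : ∀ u ∈ S, u ∈ B := by
    rintro u (⟨⟨z, hz, h⟩, hu⟩ | hu)
    · by_contra huB
      exact hu (Finset.mem_filter.2 ⟨Finset.mem_filter.2 ⟨Finset.mem_univ _, z, hz, h⟩, huB⟩)
    · exact (hPB u hu).1
  have hSS := sat_sub D C₀ B G hG hcl S hSB
  have hT_S : ∀ u ∈ B, ∀ z ∈ T, z - u ∈ D → u ∈ S := by
    intro u hu z hz h
    exact Or.inl ⟨⟨z, hz, h⟩, fun hQ => (Finset.mem_filter.1 hQ).2 hu⟩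
  have hsat_trans : ∀ {u u'}, u ∈ sat D C₀ S → Relation.ReflTransGen (lnk D C₀) u u' →
      u' ∈ sat D C₀ S := by
    rintro u u' ⟨s, hs, h⟩ h'
    exact ⟨s, hs, h.trans h'⟩
  -- hit indices
  have hhit : ∀ x ∈ I₁ ∪ I₂, x ∉ Miss → ∃ u ∈ R x, u ∈ sat D C₀ S := by
    intro x hx hxM
    have h1 : ¬ Disjoint (obs D C₀ (R x)) T := fun h => hxM (Finset.mem_filter.2 ⟨hx, h⟩)
    rw [Finset.not_disjoint_iff] at h1
    obtain ⟨z, hz, hzT⟩ := h1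
    simp only [obs, Finset.mem_filter] at hz
    obtain ⟨_, u', hu', hzu⟩ := hz
    have hu'B := sat_sub D C₀ B G hG hcl _ (hRB x hx) u' hu'
    obtain ⟨s, hs, hsu⟩ := hu'
    exact ⟨s, hs, u', hT_S u' hu'B z hzT hzu, rt_symm _ _ hsu⟩
  have hI₁ : ∀ u ∈ I₁, u ∈ sat D C₀ S := by
    intro u hu
    have huX : u ∈ X := hBX u (Finset.mem_filter.1 hu).1
    by_cases hM : u ∈ Miss
    · apply sat_self
      right
      refine Finset.mem_union_left _ (Finset.mem_image.2 ⟨u, hM, ?_⟩)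
      simp only [rep, if_pos huX]
    · obtain ⟨v, hv, h⟩ := hhit u (Finset.mem_union_left _ hu) hM
      simp only [R, if_pos huX, Set.mem_singleton_iff] at hv
      rwa [hv] at h
  have hφcov : ∀ v ∈ G, d - η ≤ ((B.filter (fun u => v - u ∈ D)).card : ℝ) →
      v ∈ cand D C₀ T Q P := by
    intro v hv hvφ
    by_cases hvC : v ∈ C₀
    · have hvI : v ∈ I₂ := Finset.mem_filter.2 ⟨hvC, hv, hvφ⟩
      have hvX := hCX v hvC
      by_cases hM : v ∈ Miss
      · refine ⟨nb v, sat_self _ _ _ (Or.inr ?_), (hnb v hv).2⟩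
        refine Finset.mem_union_left _ (Finset.mem_image.2 ⟨v, hM, ?_⟩)
        simp only [rep, if_neg hvX]
      · obtain ⟨u, hu, h⟩ := hhit v (Finset.mem_union_right _ hvI) hM
        simp only [R, if_neg hvX] at hu
        exact ⟨u, h, hu.2⟩
    · obtain ⟨u, huB, hvu⟩ := (hG v).1 hv
      have hcs := class_size X hX D C₀ B G hDX hDs hgen hBX hG hcl hGY u huB v hvu hvC
      have hpos : 0 < (obs D C₀ {u}).card := by
        have : 0 < (D + D).card := by rw [hd₂def] at hd2pos; exact_mod_cast hd2pos
        omega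
      obtain ⟨z, hz⟩ := Finset.card_pos.1 hpos
      simp only [obs, Finset.mem_filter] at hz
      obtain ⟨hzC, u', hu', hzu'⟩ := hz
      have hu'B := sat_sub D C₀ B G hG hcl {u} (by simpa using huB) u' hu'
      obtain ⟨s, hs, hsu'⟩ := hu'
      rw [Set.mem_singleton_iff] at hs
      subst hs
      have hu'I : u' ∈ I₁ := by
        refine Finset.mem_filter.2 ⟨hu'B, Finset.mem_filter.2 ⟨Finset.mem_univ _, z, hzC, hzu'⟩, ?_⟩
        rcases hsu'.cases_tail with h | ⟨u'', _, y, hy, _, hyu⟩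
        · rw [h]; exact ⟨v, hvu, hvC⟩
        · exact ⟨y, hyu, hy⟩
      exact ⟨s, hsat_trans (hI₁ u' hu'I) (rt_symm _ _ hsu'), hvu⟩
  refine ⟨T, hTC, Q, (Finset.filter_subset _ _).trans hnbrmono, P, fun u hu => (hPB u hu).2,
    ?_, ?_, ?_, ?_, hφcov, ?_⟩
  · rw [e12]; linarith
  · rw [e12]; linarith
  · rw [e12]; exact hPc
  · rintro z ⟨u, hu, h⟩
    exact (hG z).2 ⟨u, hSS u hu, h⟩
  · intro u hu
    by_cases hB1 : u ∈ B1
    · obtain ⟨u', hu', y, hy, hy'⟩ := hB'cov u hB1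
      exact ⟨y, ⟨u', sat_self _ _ _ (Or.inr (Finset.mem_union_right _ hu')), hy'⟩, hy⟩
    · have : ∃ y, y - u ∈ D ∧ y ∉ Low := by
        by_contra! hcon
        exact hB1 (Finset.mem_filter.2 ⟨hu, hcon⟩)
      obtain ⟨y, hy, hyL⟩ := this
      have hyG : y ∈ G := (hG y).2 ⟨u, hu, hy⟩
      refine ⟨y, hφcov y hyG ?_, hy⟩
      by_contra hcon
      exact hyL (Finset.mem_filter.2 ⟨hyG, not_le.1 hcon⟩)

end Main

section Fin
variable {F : Type*} [AddCommGroup F] [Fintype F]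

lemma closure_facts (X : AddSubgroup F) (hX : X.index = 2) (n : ℕ) (hn : Fintype.card F = 2 * n)
    (D C₀ : Finset F) (hDX : ∀ x ∈ D, x ∉ X) (hDs : ∀ x ∈ D, -x ∈ D)
    (A : Set F) (hAX : A ⊆ (X : Set F)) (hsmall : 2 * (closureSet (D : Set F) X A).ncard ≤ n)
    (hbd : boundarySet (D : Set F) X A ⊆ (C₀ : Set F)) :
    (∀ u ∈ closureSet (D : Set F) X A, u ∈ X) ∧
    (∀ y, y ∈ A + (D : Set F) ↔ ∃ u ∈ closureSet (D : Set F) X A, y - u ∈ D) ∧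
    (∀ y ∈ A + (D : Set F), y ∉ C₀ → ∀ u, y - u ∈ D → u ∈ closureSet (D : Set F) X A) ∧
    (∃ y, y ∉ X ∧ y ∉ A + (D : Set F)) := by
  refine ⟨fun u hu => hu.1, ?_, ?_, ?_⟩
  · intro y
    constructor
    · intro hy
      obtain ⟨a, ha, x, hx, rfl⟩ := Set.mem_add.1 hy
      refine ⟨a, ⟨hAX ha, ?_⟩, by simpa using hx⟩
      exact Set.add_subset_add_right (by simpa using ha)
    · rintro ⟨u, hu, h⟩
      exact hu.2 (Set.mem_add.2 ⟨u, rfl, y - u, h, by abel⟩)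
  · intro y hy hyC u hu
    by_contra hcon
    apply hyC
    apply hbd
    refine ⟨hy, fun h => hcon (h ?_)⟩
    exact Set.mem_add.2 ⟨y, rfl, u - y, by have := hDs _ hu; rwa [neg_sub] at this, by abel⟩
  · by_contra! hcon
    have h1 : closureSet (D : Set F) X A = (X : Set F) := by
      apply Set.Subset.antisymm (fun u hu => hu.1)
      intro u hu
      refine ⟨hu, ?_⟩
      intro y hy
      obtain ⟨v, hv, x, hx, rfl⟩ := Set.mem_add.1 hy
      rw [Set.mem_singleton_iff] at hv
      subst hv
      apply hcon
      intro h
      exact hDX x hx ((X.add_mem_cancel_left hu).1 h)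
    rw [h1] at hsmall
    have h2 := X.card_mul_index
    rw [hX, Nat.card_eq_fintype_card (α := F), hn] at h2
    have h3 : (X : Set F).ncard = Nat.card X := rfl
    have h4 : 0 < Fintype.card F := Fintype.card_pos
    omega

lemma num_count (M : Finset F) (t L d : ℝ) (ht : 0 ≤ t) (hL : 2 ≤ L) (hdL : L ≤ d)
    (hd : (2 : ℝ) ^ L = d) (hM : (M.card : ℝ) ≤ t * d ^ 3) :
    ((M.powerset.filter (fun T => (T.card : ℝ) ≤ 12 * t / L ^ 2)).card : ℝ) ≤
      2 ^ (50 * t / L) := by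
  classical
  have hLpos : 0 < L := by linarith
  have hdpos : 0 < d := by linarith
  have hx : (2 : ℝ) ^ (-(4 * L)) = 1 / d ^ 4 := by
    rw [Real.rpow_neg (by norm_num), mul_comm, Real.rpow_mul (by norm_num), hd, one_div]
    norm_num
  have h1 := count_small M (12 * t / L ^ 2) ((2 : ℝ) ^ (-(4 * L))) (by positivity)
    (Real.rpow_le_one_of_one_le_of_nonpos (by norm_num) (by linarith))
  rw [← Real.rpow_mul (by norm_num)] at h1
  have e1 : -(4 * L) * (12 * t / L ^ 2) = -(48 * t / L) := by field_simp; ring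
  rw [e1, Real.rpow_neg (by norm_num), ← div_eq_mul_inv, div_le_iff₀ (by positivity)] at h1
  have h2 : (1 + (2 : ℝ) ^ (-(4 * L))) ^ M.card ≤ 2 ^ (2 * t / L) := by
    rw [hx]
    calc (1 + 1 / d ^ 4) ^ M.card ≤ (Real.exp (1 / d ^ 4)) ^ M.card := by
          apply pow_le_pow_left₀ (by positivity)
          linarith [Real.add_one_le_exp (1 / d ^ 4)]
      _ = Real.exp (M.card * (1 / d ^ 4)) := by rw [← Real.exp_nat_mul]
      _ ≤ Real.exp (Real.log 2 * (2 * t / L)) := by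
          apply Real.exp_le_exp.2
          have h3 : (M.card : ℝ) * (1 / d ^ 4) ≤ t * d ^ 3 * (1 / d ^ 4) := by gcongr
          have h4 : t * d ^ 3 * (1 / d ^ 4) = t / d := by field_simp
          have h5 : t / d ≤ t / L := by gcongr
          have h6 : (1 / 2 : ℝ) ≤ Real.log 2 := by linarith [Real.log_two_gt_d9]
          have h7 : (1 / 2 : ℝ) * (2 * t / L) ≤ Real.log 2 * (2 * t / L) := by gcongr
          have h8 : (1 / 2 : ℝ) * (2 * t / L) = t / L := by ring
          linarith
      _ = _ := by rw [Real.rpow_def_of_pos (by norm_num)]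
  calc _ ≤ _ := h1
    _ ≤ 2 ^ (2 * t / L) * 2 ^ (48 * t / L) := by gcongr
    _ = _ := by
      rw [← Real.rpow_add (by norm_num)]
      congr 1; ring

end Fin

theorem stmt17 :
    ∃ C K₁ K₂ : ℝ, 0 < C ∧ 0 < K₁ ∧ 0 < K₂ ∧
      ∀ (n : ℕ) (F : Type) [AddCommGroup F] [Fintype F],
        Fintype.card F = 2 * n →
        ∀ X : AddSubgroup F, X.index = 2 →
          ∀ D : Set F, D ⊆ ((↑X : Set F))ᶜ → (∀ x ∈ D, -x ∈ D) →
            AddSubgroup.closure D = ⊤ →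
            ∀ d : ℕ, D.ncard = d →
              C * (logb 2 d) ^ (8 : ℕ) * logb 2 n ≤ (d : ℝ) →
              (d : ℝ) ≤ (n : ℝ) ^ ((1 : ℝ) / 3) →
              (d : ℝ) * (logb 2 d) ^ (3 : ℕ) ≤ ((D + D).ncard : ℝ) →
              ∀ a g : ℕ, ∀ C₀ : Set F, C₀ ⊆ ((↑X : Set F))ᶜ →
                (C₀.ncard : ℝ) ≤
                    K₁ * ((g : ℝ) - (a : ℝ)) * ((D + D).ncard : ℝ) / (logb 2 d) ^ 3 →
                ∃ 𝒞₂ : Set (Set F),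
                  (𝒞₂.ncard : ℝ) ≤ 2 ^ (K₂ * ((g : ℝ) - (a : ℝ)) / logb 2 d) ∧
                  ∀ A : Set F, A ⊆ (↑X : Set F) → TwoLinked D A →
                    2 * (closureSet D (↑X) A).ncard ≤ n →
                    (closureSet D (↑X) A).ncard = a → (A + D).ncard = g →
                    boundarySet D (↑X) A ⊆ C₀ →
                    ∃ F₀ ∈ 𝒞₂,
                      IsPhiApprox D (↑X) A ((d : ℝ) - Real.sqrt d / logb 2 d) F₀ := by
  refine ⟨4, 1, 150, by norm_num, by norm_num, by norm_num, ?_⟩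
  intro n F _ _ hcard X hX D hDX hDs hgen d hd hC hn hd2 a g C₀ hC₀X hC₀
  classical
  lift D to Finset F using D.toFinite
  lift C₀ to Finset F using C₀.toFinite
  rw [Set.ncard_coe_finset] at hd hC₀
  rw [← Finset.coe_add, Set.ncard_coe_finset] at hd2 hC₀
  have hDX' : ∀ x ∈ D, x ∉ X := fun x hx => hDX hx
  have hDs' : ∀ x ∈ D, -x ∈ D := fun x hx => by exact_mod_cast hDs x (by exact_mod_cast hx)
  have hC₀X' : ∀ x ∈ C₀, x ∉ X := fun x hx => hC₀X hx
  have hDne : D.Nonempty := by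
    rw [Finset.nonempty_iff_ne_empty]
    rintro rfl
    have hXtop : X = ⊤ := by
      rw [eq_top_iff, ← hgen]; simp
    rw [hXtop, AddSubgroup.index_top] at hX
    norm_num at hX
  have hd1 : 1 ≤ d := by rw [← hd]; exact Finset.card_pos.2 hDne
  have hn1 : 1 ≤ n := by
    have : 0 < Fintype.card F := Fintype.card_pos
    omega
  have hfacts := fun (A : Set F) hAX hs hb =>
    closure_facts X hX n hcard D C₀ hDX' hDs' A hAX hs hb
  have hd2c : 0 < (D + D).card := Finset.card_pos.2 (hDne.add hDne)
  rcases Nat.lt_or_ge d 2 with hdlt | hdge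
  · -- degenerate case
    have hd1' : d = 1 := by omega
    subst hd1'
    refine ⟨∅, by simp, ?_⟩
    intro A hAX hA2 hs ha hg hb
    exfalso
    have hC0 : C₀ = ∅ := by
      simp only [Nat.cast_one, Real.logb_one] at hC₀
      norm_num at hC₀
      exact hC₀
    obtain ⟨h1, h2, h3, h4⟩ := hfacts A hAX hs hb
    have hAne : A.Nonempty := by
      obtain ⟨⟨x, hx⟩⟩ := hA2.nonempty
      exact ⟨x, hx⟩
    obtain ⟨e, he⟩ := hDne
    obtain ⟨x, hx⟩ := hAne
    obtain ⟨u, hu, hxu⟩ := (h2 (x + e)).1 (Set.add_mem_add hx he)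
    have := class_size X hX D C₀ (closureSet (D : Set F) X A).toFinite.toFinset
      (A + (D : Set F)).toFinite.toFinset hDX' hDs' hgen (by simpa using h1) (by simpa only [Set.Finite.mem_toFinset] using h2)
      (by simpa only [Set.Finite.mem_toFinset] using h3) (by simpa only [Set.Finite.mem_toFinset] using h4) u (by simpa using hu) (x + e) hxu (by simp [hC0])
    have h0 : obs D C₀ {u} = ∅ := by simp [obs, hC0]
    rw [h0, Finset.card_empty] at this
    omega
  have hdR : (2 : ℝ) ≤ d := by exact_mod_cast hdge
  have hdpos : (0 : ℝ) < d := by linarith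
  set L := Real.logb 2 d with hLdef
  have hL1 : 1 ≤ L := by
    rw [hLdef, Real.le_logb_iff_rpow_le (by norm_num) hdpos]; simpa using hdR
  have hlogn : L ≤ Real.logb 2 n := by
    apply Real.logb_le_logb_of_le (by norm_num) hdpos
    refine hn.trans ?_
    have : (1 : ℝ) ≤ n := by exact_mod_cast hn1
    calc (n : ℝ) ^ ((1 : ℝ) / 3) ≤ (n : ℝ) ^ (1 : ℝ) :=
          Real.rpow_le_rpow_of_exponent_le this (by norm_num)
      _ = n := Real.rpow_one _
  have h9 : 4 * L ^ 9 ≤ d := by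
    refine le_trans ?_ hC
    have : 4 * L ^ 9 = 4 * L ^ 8 * L := by ring
    rw [this]; gcongr
  have hL2 : 2 ≤ L := by
    rw [hLdef, Real.le_logb_iff_rpow_le (by norm_num) hdpos]
    have : (1 : ℝ) ≤ L ^ 9 := one_le_pow₀ hL1
    have h4 : (4 : ℝ) ≤ d := by linarith
    norm_num
    exact_mod_cast h4
  have hLpos : 0 < L := by linarith
  have hL6 : L ^ 6 ≤ d := by
    have h1 : L ^ 6 ≤ L ^ 9 := pow_le_pow_right₀ hL1 (by norm_num)
    have h2 : 0 ≤ L ^ 9 := by positivity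
    linarith
  have hLd : L ≤ d := le_trans (by simpa using pow_le_pow_right₀ hL1 (show 1 ≤ 6 by norm_num)) hL6
  have h2L : (2 : ℝ) ^ L = d := Real.rpow_logb (by norm_num) (by norm_num) hdpos
  have hexp : Real.exp (-(4 * L)) ≤ 1 / (d : ℝ) ^ 4 := by
    rw [Real.exp_neg, ← one_div]
    apply one_div_le_one_div_of_le (by positivity)
    have h1 : (d : ℝ) ≤ Real.exp L := by
      rw [← h2L, Real.rpow_def_of_pos (by norm_num)]
      apply Real.exp_le_exp.2
      have : Real.log 2 ≤ 1 := by linarith [Real.log_two_lt_d9]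
      nlinarith
    calc (d : ℝ) ^ 4 ≤ Real.exp L ^ 4 := by gcongr
      _ = _ := by rw [← Real.exp_nat_mul]; norm_num
  set t : ℝ := (g : ℝ) - a with htdef
  have hd2pos : (0 : ℝ) < ((D + D).card : ℝ) := by exact_mod_cast hd2c
  have ht0 : 0 ≤ t := by
    have h1 : 0 ≤ 1 * t * ((D + D).card : ℝ) / L ^ 3 := le_trans (Nat.cast_nonneg _) hC₀
    by_contra hcon
    push Not at hcon
    have h2 : 1 * t * ((D + D).card : ℝ) / L ^ 3 < 0 := by
      apply div_neg_of_neg_of_pos _ (by positivity)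
      nlinarith
    linarith
  rw [one_mul] at hC₀
  have hd2le : ((D + D).card : ℝ) ≤ (d : ℝ) ^ 2 := by
    have : (D + D).card ≤ D.card * D.card := Finset.card_add_le
    rw [pow_two, ← hd]; exact_mod_cast this
  have hC₀2 : (C₀.card : ℝ) ≤ t * (d : ℝ) ^ 2 := by
    refine hC₀.trans ?_
    rw [div_le_iff₀ (by positivity)]
    have h1 : 1 ≤ L ^ 3 := one_le_pow₀ (by linarith)
    calc t * ((D + D).card : ℝ) ≤ t * (d : ℝ) ^ 2 := by gcongr
      _ ≤ t * (d : ℝ) ^ 2 * L ^ 3 := le_mul_of_one_le_right (by positivity) h1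
  have hNC : ((nbr D C₀).card : ℝ) ≤ t * (d : ℝ) ^ 3 := by
    calc ((nbr D C₀).card : ℝ) ≤ C₀.card * d := by rw [← hd]; exact_mod_cast card_nbr_le D C₀
      _ ≤ t * (d : ℝ) ^ 2 * d := by gcongr
      _ = _ := by ring
  have hC₀3 : (C₀.card : ℝ) ≤ t * (d : ℝ) ^ 3 := by
    have : (d : ℝ) ^ 2 ≤ (d : ℝ) ^ 3 := pow_le_pow_right₀ (by linarith) (by norm_num)
    refine hC₀2.trans (by gcongr)
  let sm : Finset F → Finset (Finset F) := fun M =>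
    M.powerset.filter (fun T => (T.card : ℝ) ≤ 12 * t / L ^ 2)
  let Fam : Finset (Finset F × Finset F × Finset F) := sm C₀ ×ˢ sm (nbr D C₀) ×ˢ sm (nbr D C₀)
  refine ⟨(fun p : Finset F × Finset F × Finset F => cand D C₀ p.1 p.2.1 p.2.2) ''
    (Fam : Set (Finset F × Finset F × Finset F)), ?_, ?_⟩
  · have h1 : ((fun p : Finset F × Finset F × Finset F => cand D C₀ p.1 p.2.1 p.2.2) ''
        (Fam : Set (Finset F × Finset F × Finset F))).ncard ≤ Fam.card := by
      rw [← Set.ncard_coe_finset Fam]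
      exact Set.ncard_image_le (Finset.finite_toSet Fam)
    have h2 : Fam.card = (sm C₀).card * ((sm (nbr D C₀)).card * (sm (nbr D C₀)).card) := by
      simp only [Fam, Finset.card_product]
    have c1 := num_count C₀ t L d ht0 hL2 hLd h2L hC₀3
    have c2 := num_count (nbr D C₀) t L d ht0 hL2 hLd h2L hNC
    calc _ ≤ (Fam.card : ℝ) := by exact_mod_cast h1
      _ = ((sm C₀).card : ℝ) * (((sm (nbr D C₀)).card : ℝ) * ((sm (nbr D C₀)).card : ℝ)) := by
          rw [h2]; push_cast; rfl
      _ ≤ 2 ^ (50 * t / L) * (2 ^ (50 * t / L) * 2 ^ (50 * t / L)) := by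
          apply mul_le_mul c1 (mul_le_mul c2 c2 (by positivity) (by positivity))
            (by positivity) (by positivity)
      _ = _ := by
          rw [← Real.rpow_add (by norm_num), ← Real.rpow_add (by norm_num)]
          congr 1; ring
  · intro A hAX hA2 hs ha hg hb
    obtain ⟨h1, h2, h3, h4⟩ := hfacts A hAX hs hb
    have hBc : (closureSet (D : Set F) X A).toFinite.toFinset.card = a := by
      rw [← ha, Set.ncard_eq_toFinset_card]
    have hGc : (A + (D : Set F)).toFinite.toFinset.card = g := by
      rw [← hg, Set.ncard_eq_toFinset_card]
    obtain ⟨T, hT, Q, hQ, P, hP, hTc, hQc, hPc, r1, r2, r3⟩ :=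
      core_s17 X hX D C₀ (closureSet (D : Set F) X A).toFinite.toFinset
      (A + (D : Set F)).toFinite.toFinset hDX' hDs' hgen hC₀X' (by simpa using h1)
      (by simpa only [Set.Finite.mem_toFinset] using h2) (by simpa only [Set.Finite.mem_toFinset] using h3) (by simpa only [Set.Finite.mem_toFinset] using h4) L t d ((D + D).card : ℝ)
      (by rw [hd]) rfl hL2 hL6 hd2 (by rw [hBc, hGc]) ht0 hC₀ hexp
    refine ⟨cand D C₀ T Q P, ⟨(T, Q, P), ?_, rfl⟩, ?_, ?_, ?_⟩
    · simp only [Fam, sm, Finset.coe_product, Set.mem_prod, Finset.mem_coe, Finset.mem_filter,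
        Finset.mem_powerset]
      exact ⟨⟨hT, hTc⟩, ⟨hQ, hQc⟩, ⟨hP, hPc⟩⟩
    · intro z hz
      simpa only [Set.Finite.mem_toFinset] using r1 z hz
    · rintro v ⟨hv, hφ⟩
      apply r2 v (by simpa only [Set.Finite.mem_toFinset] using hv)
      refine hφ.trans (le_of_eq ?_)
      rw [← Set.ncard_coe_finset]
      congr 2
      ext u
      simp only [Set.mem_inter_iff, Finset.coe_filter, Set.Finite.mem_toFinset, Set.mem_ofPred_eq]
      constructor
      · rintro ⟨hu, huB⟩
        obtain ⟨v', hv', x, hx, rfl⟩ := Set.mem_add.1 hu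
        rw [Set.mem_singleton_iff] at hv'
        subst hv'
        exact ⟨huB, by simpa using hDs' x hx⟩
      · rintro ⟨huB, hu⟩
        refine ⟨Set.mem_add.2 ⟨v, rfl, u - v, ?_, by abel⟩, huB⟩
        have := hDs' _ hu
        rwa [neg_sub] at this
    · intro u hu
      obtain ⟨z, hz, hzu⟩ := r3 u (by simpa using hu)
      refine Set.mem_add.2 ⟨z, hz, u - z, ?_, by abel⟩
      have := hDs' _ hzu
      rwa [neg_sub] at this
end

section
/- There exist absolute constants C, K > 0 with the following property. Let F be a finite abelian group of order 2n, X a subgroup of F of index 2 with coset Y = F \ X, and D ⊆ Y a generating set of F with D = −D, |D| = d, such that d ≥ C · (log d)^8 · (log n), d ≤ n^{1/3}, and |2D| ≥ d · (log d)^3. Then for all integers a, g with t = g − a and every set F₀ ⊆ Y, there exists a family 𝒞₃ of pairs (S, F₁) with S ⊆ X and F₁ ⊆ Y, of size at most 2^{K · t · (log d)^4 / √d}, such that for every small 2-linked set A ⊆ X with |[A]| = a and |N(A)| = g for which F₀ is a φ-approximation (φ = d − √d/log d), some pair in 𝒞₃ is a ψ-approximation for A, where ψ = d/log d. -/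
open Pointwise Real

/-- `(S, F₁)` is a `ψ`-approximation for `A`: `S ⊇ [A]`, `F₁ ⊆ G`, every `u ∈ S` has at
least `d − ψ` neighbors in `F₁`, and every `v ∈ Y \ F₁` has at least `d − ψ` neighbors in
`X \ S` (here `Y = Xᶜ` and the degree is `d = |D|`). -/
def IsPsiApprox {F : Type*} [AddCommGroup F] (D X A : Set F) (d : ℕ) (ψ : ℝ)
    (S F₁ : Set F) : Prop :=
  closureSet D X A ⊆ S ∧ F₁ ⊆ A + D ∧
  (∀ u ∈ S, (d : ℝ) - ψ ≤ ((({u} + D) ∩ F₁).ncard : ℝ)) ∧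
  (∀ v ∈ Xᶜ \ F₁, (d : ℝ) - ψ ≤ ((({v} + D) ∩ (X \ S)).ncard : ℝ))


namespace Stmt18Aux

open Finset

lemma count_small {V : Type*} [DecidableEq V] (s : Finset V) (d : ℕ) (hd : 1 ≤ d) (m M : ℝ)
    (hM : (#s : ℝ) ≤ M) :
    (#(s.powerset.filter (fun T => (#T : ℝ) ≤ m)) : ℝ) ≤
      (2 : ℝ) ^ (2 * logb 2 d * m + 2 * M / (d : ℝ) ^ 2) := by
  have hd0 : (0 : ℝ) < d := by exact_mod_cast hd
  have hd1 : (1 : ℝ) ≤ d := by exact_mod_cast hd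
  set x : ℝ := ((d : ℝ) ^ 2)⁻¹ with hx
  have hx0 : 0 < x := by positivity
  have hx1 : x ≤ 1 := inv_le_one_of_one_le₀ (one_le_pow₀ hd1)
  have h1 : ∑ T ∈ s.powerset, x ^ #T = (x + 1) ^ #s := by
    rw [← Finset.sum_pow_mul_eq_add_pow]; simp
  have h2 : (#(s.powerset.filter (fun T => (#T : ℝ) ≤ m)) : ℝ) * x ^ m ≤ (x + 1) ^ #s := by
    rw [← h1, ← nsmul_eq_mul]
    calc _ ≤ ∑ T ∈ s.powerset.filter (fun T => (#T : ℝ) ≤ m), x ^ #T := by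
          apply Finset.card_nsmul_le_sum
          intro T hT
          rw [← Real.rpow_natCast]
          exact Real.rpow_le_rpow_of_exponent_ge hx0 hx1 (Finset.mem_filter.1 hT).2
      _ ≤ _ := Finset.sum_le_sum_of_subset_of_nonneg (Finset.filter_subset _ _)
          (fun _ _ _ => by positivity)
  have h3 : x ^ m = (2 : ℝ) ^ (-(2 * logb 2 d * m)) := by
    have : x = (2 : ℝ) ^ (-(2 * logb 2 d)) := by
      rw [Real.rpow_neg (by norm_num), hx, mul_comm, Real.rpow_mul (by norm_num),
        Real.rpow_logb (by norm_num) (by norm_num) hd0]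
      norm_num
    rw [this, ← Real.rpow_mul (by norm_num)]; ring_nf
  have h4 : (x + 1) ^ #s ≤ (2 : ℝ) ^ (2 * M / (d : ℝ) ^ 2) := by
    calc (x + 1) ^ #s ≤ (Real.exp x) ^ #s := by
          gcongr; exact Real.add_one_le_exp x
      _ = Real.exp (#s * x) := by rw [← Real.exp_nat_mul]
      _ ≤ Real.exp (Real.log 2 * (2 * M / (d : ℝ) ^ 2)) := by
          apply Real.exp_le_exp.2
          have hl : (1 / 2 : ℝ) ≤ Real.log 2 := by linarith [Real.log_two_gt_d9]
          have hM0 : 0 ≤ M := le_trans (by positivity) hM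
          calc (#s : ℝ) * x ≤ M * x := by gcongr
            _ = 1 / 2 * (2 * M / (d : ℝ) ^ 2) := by rw [hx]; field_simp
            _ ≤ _ := by gcongr
      _ = _ := by rw [Real.rpow_def_of_pos (by norm_num)]
  rw [h3, Real.rpow_neg (by norm_num)] at h2
  rw [Real.rpow_add (by norm_num)]
  have h5 : (0 : ℝ) < 2 ^ (2 * logb 2 d * m) := by positivity
  rw [← div_eq_mul_inv, div_le_iff₀ h5] at h2
  calc _ ≤ _ := h2
    _ ≤ _ := by rw [mul_comm]; gcongr

lemma greedy {V : Type*} [DecidableEq V] (N : V → Finset V) (B P : Finset V) (ψ : ℝ)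
    (hψ : 0 ≤ ψ) :
    ∃ U ⊆ P, (∀ u ∈ U, ψ < (#(N u \ B) : ℝ)) ∧ ψ * #U ≤ (#(U.biUnion N \ B) : ℝ) ∧
      ∀ u ∈ P, (#(N u \ (B ∪ U.biUnion N)) : ℝ) ≤ ψ := by
  classical
  let fam := P.powerset.filter (fun U => (∀ u ∈ U, ψ < (#(N u \ B) : ℝ)) ∧
    ψ * #U ≤ (#(U.biUnion N \ B) : ℝ))
  have hne : fam.Nonempty := ⟨∅, by simp [fam]⟩
  obtain ⟨U, hU, hmax⟩ := Finset.exists_max_image fam Finset.card hne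
  simp only [fam, Finset.mem_filter, Finset.mem_powerset] at hU hmax
  refine ⟨U, hU.1, hU.2.1, hU.2.2, ?_⟩
  intro u hu
  by_contra! hlt
  have hnot : u ∉ U := by
    intro h
    have : N u \ (B ∪ U.biUnion N) = ∅ := by
      rw [Finset.sdiff_eq_empty_iff_subset]
      exact (Finset.subset_biUnion_of_mem N h).trans Finset.subset_union_right
    rw [this] at hlt
    simp at hlt; linarith
  have hsub : (#(N u \ (B ∪ U.biUnion N)) : ℝ) ≤ #(N u \ B) := by
    exact_mod_cast Finset.card_le_card
      (Finset.sdiff_subset_sdiff subset_rfl Finset.subset_union_left)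
  have := hmax (insert u U) ⟨Finset.insert_subset hu hU.1, ?_, ?_⟩
  · rw [Finset.card_insert_of_notMem hnot] at this; omega
  · intro w hw
    rcases Finset.mem_insert.1 hw with rfl | hw
    · linarith
    · exact hU.2.1 w hw
  · rw [Finset.card_insert_of_notMem hnot]
    have hc : #(N u \ (B ∪ U.biUnion N)) + #(U.biUnion N \ B) ≤
        #((insert u U).biUnion N \ B) := by
      rw [← Finset.card_union_of_disjoint]
      · apply Finset.card_le_card
        rw [Finset.biUnion_insert]
        intro y; simp only [Finset.mem_union, Finset.mem_sdiff]; tauto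
      · rw [Finset.disjoint_left]; intro y; simp only [Finset.mem_union, Finset.mem_sdiff]; tauto
    have hc' : (#(N u \ (B ∪ U.biUnion N)) : ℝ) + #(U.biUnion N \ B) ≤
        #((insert u U).biUnion N \ B) := by exact_mod_cast hc
    push_cast
    linarith [hU.2.2]

lemma dc {V : Type*} [DecidableEq V] (N : V → Finset V) (sym : ∀ u v, u ∈ N v → v ∈ N u)
    (P Q : Finset V) : ∑ u ∈ P, #(N u ∩ Q) = ∑ v ∈ Q, #(N v ∩ P) := by
  have h : ∀ A B : Finset V, ∀ u, #(N u ∩ B) = ∑ v ∈ B, if v ∈ N u then 1 else 0 := by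
    intro A B u
    rw [Finset.sum_boole, Finset.inter_comm, Finset.filter_mem_eq_inter]; simp
  rw [Finset.sum_congr rfl (fun u _ => h P Q u), Finset.sum_congr rfl (fun u _ => h Q P u),
    Finset.sum_comm]
  refine Finset.sum_congr rfl fun v _ => Finset.sum_congr rfl fun u _ => ?_
  have : v ∈ N u ↔ u ∈ N v := ⟨sym v u, sym u v⟩
  simp [this]

lemma markov {V : Type*} [DecidableEq V] (N : V → Finset V) (sym : ∀ u v, u ∈ N v → v ∈ N u)
    (d : ℕ) (reg : ∀ u, #(N u) = d) (P Q : Finset V) (r : ℝ)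
    (h : ∀ u ∈ P, r ≤ (#(N u ∩ Q) : ℝ)) : r * #P ≤ d * #Q := by
  have h1 : (#P : ℝ) * r ≤ ∑ u ∈ P, (#(N u ∩ Q) : ℝ) := by
    rw [← nsmul_eq_mul]; exact Finset.card_nsmul_le_sum _ _ _ h
  have h2 : ∑ u ∈ P, (#(N u ∩ Q) : ℝ) = ∑ v ∈ Q, (#(N v ∩ P) : ℝ) := by
    exact_mod_cast dc N sym P Q
  have h3 : ∑ v ∈ Q, (#(N v ∩ P) : ℝ) ≤ #Q * (d : ℝ) := by
    rw [← nsmul_eq_mul]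
    apply Finset.sum_le_card_nsmul
    intro v _
    rw [← reg v]
    exact_mod_cast Finset.card_le_card Finset.inter_subset_left
  linarith

lemma edges {V : Type*} [DecidableEq V] (N : V → Finset V) (sym : ∀ u v, u ∈ N v → v ∈ N u)
    (d : ℕ) (reg : ∀ u, #(N u) = d) (C G : Finset V) (hCG : ∀ u ∈ C, N u ⊆ G) :
    ∑ v ∈ G, (#(N v \ C) : ℝ) = d * ((#G : ℝ) - #C) := by
  have h1 : ∑ v ∈ G, (#(N v ∩ C) : ℝ) = #C * (d : ℝ) := by
    have : ∑ v ∈ G, #(N v ∩ C) = #C * d := by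
      rw [dc N sym, ← smul_eq_mul]
      apply Finset.sum_const_nat (m := d)
      intro u hu
      rw [Finset.inter_eq_left.2 (hCG u hu), reg]
    exact_mod_cast this
  have h2 : ∑ v ∈ G, ((#(N v \ C) : ℝ) + #(N v ∩ C)) = #G * (d : ℝ) := by
    rw [← nsmul_eq_mul]
    apply Finset.sum_eq_card_nsmul
    intro v _
    rw [← reg v]
    exact_mod_cast Finset.card_sdiff_add_card_inter (N v) C
  rw [Finset.sum_add_distrib, h1] at h2
  linarith

lemma edges_out {V : Type*} [DecidableEq V] (N : V → Finset V)
    (sym : ∀ u v, u ∈ N v → v ∈ N u)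
    (d : ℕ) (reg : ∀ u, #(N u) = d) (C G P : Finset V) (hCG : ∀ u ∈ C, N u ⊆ G)
    (hP : ∀ u ∈ P, u ∉ C) (r : ℝ) (h : ∀ u ∈ P, r ≤ (#(N u ∩ G) : ℝ)) :
    r * #P ≤ d * ((#G : ℝ) - #C) := by
  rw [← edges N sym d reg C G hCG]
  have h1 : (#P : ℝ) * r ≤ ∑ u ∈ P, (#(N u ∩ G) : ℝ) := by
    rw [← nsmul_eq_mul]; exact Finset.card_nsmul_le_sum _ _ _ h
  have h2 : ∑ u ∈ P, (#(N u ∩ G) : ℝ) = ∑ v ∈ G, (#(N v ∩ P) : ℝ) := by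
    exact_mod_cast dc N sym P G
  have h3 : ∑ v ∈ G, (#(N v ∩ P) : ℝ) ≤ ∑ v ∈ G, (#(N v \ C) : ℝ) := by
    apply Finset.sum_le_sum
    intro v _
    have : N v ∩ P ⊆ N v \ C := by
      intro y hy
      rw [Finset.mem_inter] at hy
      exact Finset.mem_sdiff.2 ⟨hy.1, hP y hy.2⟩
    exact_mod_cast Finset.card_le_card this
  linarith

/-- First-stage data. -/
def Good {V : Type*} [DecidableEq V] (N : V → Finset V) (X : Finset V) (φ : ℝ)
    (F₀ C G : Finset V) : Prop :=
  C ⊆ X ∧ (∀ v ∈ G, v ∉ X) ∧ (∀ u ∈ C, N u ⊆ G) ∧ F₀ ⊆ G ∧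
  (∀ v ∈ G, φ ≤ (#(N v ∩ C) : ℝ) → v ∈ F₀) ∧ (∀ u ∈ C, ∃ v ∈ F₀, v ∈ N u)

lemma exp_bound (s L t d m M : ℝ) (hs : 0 < s) (hd : d = s ^ 2) (hL : 2 ≤ L)
    (hLs : L ^ 2 ≤ s) (ht : 0 ≤ t) (hm : m = L ^ 2 * t / s) (hM : M = 2 * s ^ 2 * t) :
    (2 * L * m + 2 * M / d ^ 2) + (2 * L * m + 2 * M / d ^ 2) ≤ 12 * t * L ^ 4 / s := by
  subst hm hM hd
  have h1 : 2 * L * (L ^ 2 * t / s) = 2 * L ^ 3 * (t / s) := by ring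
  have h2 : 2 * (2 * s ^ 2 * t) / (s ^ 2) ^ 2 = 4 / s * (t / s) := by field_simp; norm_num; ring
  have h3 : 12 * t * L ^ 4 / s = 12 * L ^ 4 * (t / s) := by ring
  rw [h1, h2, h3]
  have hts : 0 ≤ t / s := by positivity
  have h4 : 4 / s ≤ 1 := by rw [div_le_one hs]; nlinarith
  have h5 : L ^ 3 ≤ L ^ 4 := by gcongr <;> linarith
  have h6 : 1 ≤ L ^ 4 := one_le_pow₀ (by linarith)
  nlinarith

lemma core {V : Type*} [Fintype V] [DecidableEq V] (N : V → Finset V)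
    (sym : ∀ u v, u ∈ N v → v ∈ N u)
    (d : ℕ) (reg : ∀ u, #(N u) = d) (X : Finset V) (bipX : ∀ v, v ∉ X → N v ⊆ X)
    (hd : 1 ≤ d) (hL : 2 ≤ logb 2 d) (hLs : (logb 2 d) ^ 2 ≤ √(d : ℝ)) (a g : ℕ)
    (F₀ : Finset V) :
    ∃ 𝒞 : Finset (Finset V × Finset V),
      (#𝒞 : ℝ) ≤ 2 ^ (12 * ((g : ℝ) - a) * (logb 2 d) ^ 4 / √(d : ℝ)) ∧
      ∀ C G : Finset V, #C = a → #G = g → Good N X ((d : ℝ) - √(d : ℝ) / logb 2 d) F₀ C G →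
        ∃ p ∈ 𝒞, C ⊆ p.1 ∧ p.2 ⊆ G ∧
          (∀ u ∈ p.1, (d : ℝ) - d / logb 2 d ≤ (#(N u ∩ p.2) : ℝ)) ∧
          (∀ v, v ∉ X → v ∉ p.2 → (d : ℝ) - d / logb 2 d ≤ (#(N v ∩ (X \ p.1)) : ℝ)) := by
  classical
  set L := logb 2 (d : ℝ) with hLdef
  set s := √(d : ℝ) with hsdef
  set ψ : ℝ := (d : ℝ) / L with hψdef
  set t : ℝ := (g : ℝ) - a with htdef
  have hL0 : 0 < L := by linarith
  have hd0 : (0 : ℝ) < d := by exact_mod_cast hd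
  have hs0 : 0 < s := Real.sqrt_pos.2 hd0
  have hds : (d : ℝ) = s ^ 2 := (Real.sq_sqrt hd0.le).symm
  have hψ0 : 0 < ψ := by positivity
  set m : ℝ := L ^ 2 * t / s with hm
  set M : ℝ := 2 * s ^ 2 * t with hM
  by_cases hex : ∃ C G : Finset V, #C = a ∧ #G = g ∧ Good N X ((d : ℝ) - s / L) F₀ C G
  swap
  · refine ⟨∅, by simp; positivity, ?_⟩
    intro C G h1 h2 h3
    exact absurd ⟨C, G, h1, h2, h3⟩ hex
  -- bounds for good pairs
  have hx : ∀ C G : Finset V, #C = a → #G = g → Good N X ((d : ℝ) - s / L) F₀ C G →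
      (#(G \ F₀) : ℝ) ≤ s * L * t := by
    intro C G hC hG ⟨g1, g2, g3, g4, g5, g6⟩
    have h1 : (#(G \ F₀) : ℝ) * (s / L) ≤ ∑ v ∈ G \ F₀, (#(N v \ C) : ℝ) := by
      rw [← nsmul_eq_mul]
      apply Finset.card_nsmul_le_sum
      intro v hv
      rw [Finset.mem_sdiff] at hv
      have h2 : (#(N v ∩ C) : ℝ) < d - s / L := by
        by_contra! h
        exact hv.2 (g5 v hv.1 h)
      have h3 : (#(N v \ C) : ℝ) + #(N v ∩ C) = d := by
        rw [← reg v]; exact_mod_cast Finset.card_sdiff_add_card_inter (N v) C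
      linarith
    have h2 : ∑ v ∈ G \ F₀, (#(N v \ C) : ℝ) ≤ ∑ v ∈ G, (#(N v \ C) : ℝ) :=
      Finset.sum_le_sum_of_subset_of_nonneg Finset.sdiff_subset (fun _ _ _ => Nat.cast_nonneg _)
    rw [edges N sym d reg C G g3, hC, hG, ← htdef, hds] at h2
    have h3 : (#(G \ F₀) : ℝ) * (s / L) ≤ s ^ 2 * t := h1.trans h2
    have h4 : (#(G \ F₀) : ℝ) * s ≤ s ^ 2 * t * L := by
      rw [← mul_div_assoc, div_le_iff₀ hL0] at h3; exact h3
    have : (#(G \ F₀) : ℝ) * s ≤ (s * L * t) * s := by linarith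
    exact le_of_mul_le_mul_right this hs0
  have ht0 : 0 ≤ t := by
    obtain ⟨C, G, hC, hG, hgood⟩ := hex
    have h1 := edges N sym d reg C G hgood.2.2.1
    have h2 : 0 ≤ ∑ v ∈ G, (#(N v \ C) : ℝ) := Finset.sum_nonneg fun _ _ => Nat.cast_nonneg _
    rw [h1, hC, hG] at h2
    exact nonneg_of_mul_nonneg_right h2 hd0
  set Q : Finset V := X.filter (fun u => (∃ v ∈ F₀, v ∈ N u) ∧ ψ < (#(N u \ F₀) : ℝ)) with hQ
  have hQM : (#Q : ℝ) ≤ M := by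
    obtain ⟨C, G, hC, hG, hgood⟩ := hex
    have hx' := hx C G hC hG hgood
    obtain ⟨g1, g2, g3, g4, g5, g6⟩ := hgood
    have h1 : ψ * #(Q ∩ C) ≤ d * #(G \ F₀) := by
      apply markov N sym d reg
      intro u hu
      rw [Finset.mem_inter, hQ, Finset.mem_filter] at hu
      refine hu.1.2.2.le.trans ?_
      have : N u \ F₀ ⊆ N u ∩ (G \ F₀) := by
        intro y hy
        rw [Finset.mem_sdiff] at hy
        exact Finset.mem_inter.2 ⟨hy.1, Finset.mem_sdiff.2 ⟨g3 u hu.2 hy.1, hy.2⟩⟩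
      exact_mod_cast Finset.card_le_card this
    have h2 : 1 * (#(Q \ C) : ℝ) ≤ d * ((#G : ℝ) - #C) := by
      apply edges_out N sym d reg C G _ g3
      · intro u hu; exact (Finset.mem_sdiff.1 hu).2
      · intro u hu
        rw [Finset.mem_sdiff, hQ, Finset.mem_filter] at hu
        obtain ⟨v, hv, hvu⟩ := hu.1.2.1
        have : 0 < #(N u ∩ G) := Finset.card_pos.2 ⟨v, Finset.mem_inter.2 ⟨hvu, g4 hv⟩⟩
        exact_mod_cast this
    rw [hC, hG, ← htdef] at h2
    have h3 : (#(Q ∩ C) : ℝ) ≤ L * #(G \ F₀) := by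
      rw [hψdef, div_mul_eq_mul_div, div_le_iff₀ hL0] at h1
      have : (d : ℝ) * #(Q ∩ C) ≤ d * (L * #(G \ F₀)) := by linarith
      exact le_of_mul_le_mul_left this hd0
    have h4 : (#(Q \ C) : ℝ) + #(Q ∩ C) = #Q := by
      exact_mod_cast Finset.card_sdiff_add_card_inter Q C
    have h5 : L * #(G \ F₀) ≤ L * (s * L * t) := by gcongr
    have h6 : L * (s * L * t) ≤ s ^ 2 * t := by
      have := mul_le_mul_of_nonneg_right hLs (mul_nonneg hs0.le ht0)
      linarith
    rw [hds] at h2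
    linarith
  let F2 : Finset V → Finset V := fun U => F₀ ∪ U.biUnion N
  let S2 : Finset V → Finset V := fun U =>
    X.filter (fun u => (d : ℝ) - ψ ≤ (#(N u ∩ F2 U) : ℝ))
  let T : Finset V → Finset V := fun U =>
    (Finset.univ \ (X ∪ F2 U)).filter (fun v => ψ < (#(N v ∩ S2 U) : ℝ))
  let fam1 := Q.powerset.filter (fun U => (#U : ℝ) ≤ m)
  let fam2 : Finset V → Finset (Finset V) := fun U =>
    if (#(T U) : ℝ) ≤ M then (T U).powerset.filter (fun W => (#W : ℝ) ≤ m) else ∅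
  let S1 : Finset V → Finset V → Finset V := fun U W => S2 U \ W.biUnion N
  let F1 : Finset V → Finset V → Finset V := fun U W =>
    F2 U ∪ (Finset.univ \ X).filter (fun v => ψ < (#(N v ∩ S1 U W) : ℝ))
  refine ⟨fam1.biUnion (fun U => (fam2 U).image (fun W => (S1 U W, F1 U W))), ?_, ?_⟩
  · set E : ℝ := (2 : ℝ) ^ (2 * L * m + 2 * M / (d : ℝ) ^ 2) with hE
    have hE0 : 0 < E := by positivity
    have hc1 : (#fam1 : ℝ) ≤ E := count_small Q d hd m M hQM
    have hc2 : ∀ U, (#(fam2 U) : ℝ) ≤ E := by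
      intro U
      by_cases h : (#(T U) : ℝ) ≤ M
      · simp only [fam2, if_pos h]
        exact count_small (T U) d hd m M h
      · simp only [fam2, if_neg h]
        simpa using hE0.le
    calc _ ≤ ((∑ U ∈ fam1, #((fam2 U).image (fun W => (S1 U W, F1 U W))) : ℕ) : ℝ) := by
          exact_mod_cast Finset.card_biUnion_le
      _ ≤ ∑ U ∈ fam1, E := by
          push_cast
          apply Finset.sum_le_sum
          intro U _
          refine le_trans ?_ (hc2 U)
          exact_mod_cast Finset.card_image_le
      _ = #fam1 * E := by simp
      _ ≤ E * E := by gcongr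
      _ = (2 : ℝ) ^ ((2 * L * m + 2 * M / (d : ℝ) ^ 2) + (2 * L * m + 2 * M / (d : ℝ) ^ 2)) := by
          rw [Real.rpow_add (by norm_num)]
      _ ≤ _ := Real.rpow_le_rpow_of_exponent_le (by norm_num)
          (exp_bound s L t d m M hs0 hds hL hLs ht0 hm hM)
  · intro C G hC hG hgood
    have hx' := hx C G hC hG hgood
    obtain ⟨g1, g2, g3, g4, g5, g6⟩ := hgood
    obtain ⟨U, hUC, hU1, hU2, hU3⟩ := greedy N F₀ C ψ hψ0.le
    have hUQ : U ⊆ Q := by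
      intro u hu
      exact Finset.mem_filter.2 ⟨g1 (hUC hu), g6 u (hUC hu), hU1 u hu⟩
    have hUN : U.biUnion N ⊆ G := Finset.biUnion_subset.2 fun u hu => g3 u (hUC hu)
    have hF2G : F2 U ⊆ G := Finset.union_subset g4 hUN
    have hUm : (#U : ℝ) ≤ m := by
      have h1 : (#(U.biUnion N \ F₀) : ℝ) ≤ #(G \ F₀) := by
        exact_mod_cast Finset.card_le_card (Finset.sdiff_subset_sdiff hUN subset_rfl)
      have h2 : ψ * #U ≤ s * L * t := by linarith
      rw [hψdef, hds, div_mul_eq_mul_div, div_le_iff₀ hL0] at h2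
      rw [hm, le_div_iff₀ hs0]
      have : s * (#U * s) ≤ s * (L ^ 2 * t) := by linarith
      exact le_of_mul_le_mul_left this hs0
    have hCS2 : C ⊆ S2 U := by
      intro u hu
      refine Finset.mem_filter.2 ⟨g1 hu, ?_⟩
      have h1 := hU3 u hu
      have h2 : (#(N u \ F2 U) : ℝ) + #(N u ∩ F2 U) = d := by
        rw [← reg u]; exact_mod_cast Finset.card_sdiff_add_card_inter (N u) (F2 U)
      simp only [F2] at h2 ⊢
      linarith
    have hy : (#(S2 U \ C) : ℝ) ≤ 2 * t := by
      have h1 : ((d : ℝ) - ψ) * #(S2 U \ C) ≤ d * ((#G : ℝ) - #C) := by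
        apply edges_out N sym d reg C G _ g3
        · intro u hu; exact (Finset.mem_sdiff.1 hu).2
        · intro u hu
          rw [Finset.mem_sdiff, Finset.mem_filter] at hu
          refine hu.1.2.trans ?_
          exact_mod_cast Finset.card_le_card (Finset.inter_subset_inter subset_rfl hF2G)
      rw [hC, hG, ← htdef] at h1
      have h2 : ψ ≤ d / 2 := by
        rw [hψdef]; gcongr
      have h3 : (d : ℝ) / 2 * #(S2 U \ C) ≤ ((d : ℝ) - ψ) * #(S2 U \ C) := by
        exact mul_le_mul_of_nonneg_right (by linarith) (Nat.cast_nonneg _)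
      have : (d : ℝ) * #(S2 U \ C) ≤ d * (2 * t) := by linarith
      exact le_of_mul_le_mul_left this hd0
    have hNvC : ∀ v, v ∉ G → ∀ y ∈ N v, y ∉ C := by
      intro v hv y hy hyC
      exact hv (g3 y hyC (sym y v hy))
    have hTM : (#(T U) : ℝ) ≤ M := by
      have h1 : (#(T U ∩ G) : ℝ) ≤ #(G \ F₀) := by
        have : T U ∩ G ⊆ G \ F₀ := by
          intro y hy
          simp only [T, F2, Finset.mem_inter, Finset.mem_filter, Finset.mem_sdiff,
            Finset.mem_union] at hy
          exact Finset.mem_sdiff.2 ⟨hy.2, fun h => hy.1.1.2 (Or.inr (Or.inl h))⟩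
        exact_mod_cast Finset.card_le_card this
      have h2 : ψ * #(T U \ G) ≤ d * #(S2 U \ C) := by
        apply markov N sym d reg
        intro v hv
        rw [Finset.mem_sdiff, Finset.mem_filter] at hv
        refine hv.1.2.le.trans ?_
        have : N v ∩ S2 U ⊆ N v ∩ (S2 U \ C) := by
          intro y hy
          rw [Finset.mem_inter] at hy
          exact Finset.mem_inter.2 ⟨hy.1, Finset.mem_sdiff.2 ⟨hy.2, hNvC v hv.2 y hy.1⟩⟩
        exact_mod_cast Finset.card_le_card this
      have h3 : (#(T U \ G) : ℝ) ≤ L * #(S2 U \ C) := by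
        rw [hψdef, div_mul_eq_mul_div, div_le_iff₀ hL0] at h2
        have : (d : ℝ) * #(T U \ G) ≤ d * (L * #(S2 U \ C)) := by linarith
        exact le_of_mul_le_mul_left this hd0
      have h4 : (#(T U \ G) : ℝ) + #(T U ∩ G) = #(T U) := by
        exact_mod_cast Finset.card_sdiff_add_card_inter (T U) G
      have h5 : L * #(S2 U \ C) ≤ L * (2 * t) := by gcongr
      have h7 : L ≤ s := by nlinarith
      have h8 : s * L * t ≤ s * s * t := by gcongr
      have h9 : L * (2 * t) ≤ s * (s * t) := by
        have : 2 ≤ s := by linarith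
        gcongr
      rw [hM]
      linarith
    obtain ⟨W, hWG, hW1, hW2, hW3⟩ := greedy N (Finset.univ \ S2 U) (Finset.univ \ (X ∪ G)) ψ hψ0.le
    have hsd : ∀ Z : Finset V, Z \ (Finset.univ \ S2 U) = Z ∩ S2 U := by
      intro Z; ext y; simp
    have hWG' : ∀ v ∈ W, v ∉ X ∧ v ∉ G := by
      intro v hv
      have := hWG hv
      simpa using this
    have hWT : W ⊆ T U := by
      intro v hv
      have h1 := hWG' v hv
      have h2 := hW1 v hv
      rw [hsd] at h2
      refine Finset.mem_filter.2 ⟨?_, h2⟩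
      simp only [Finset.mem_sdiff, Finset.mem_univ, true_and, Finset.mem_union, not_or]
      exact ⟨h1.1, fun h => h1.2 (hF2G h)⟩
    have hWC : ∀ y ∈ W.biUnion N, y ∉ C := by
      intro y hy
      obtain ⟨v, hv, hyv⟩ := Finset.mem_biUnion.1 hy
      exact hNvC v (hWG' v hv).2 y hyv
    have hWm : (#W : ℝ) ≤ m := by
      rw [hsd] at hW2
      have h1 : (#(W.biUnion N ∩ S2 U) : ℝ) ≤ #(S2 U \ C) := by
        have : W.biUnion N ∩ S2 U ⊆ S2 U \ C := by
          intro y hy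
          rw [Finset.mem_inter] at hy
          exact Finset.mem_sdiff.2 ⟨hy.2, hWC y hy.1⟩
        exact_mod_cast Finset.card_le_card this
      have h2 : ψ * #W ≤ 2 * t := by linarith
      rw [hψdef, hds, div_mul_eq_mul_div, div_le_iff₀ hL0] at h2
      rw [hm, le_div_iff₀ hs0]
      have h7 : L ≤ s := by nlinarith
      have h8 : 2 * t * L ≤ s * (L ^ 2 * t) := by
        have : 2 ≤ s := by linarith
        have h : 2 * (t * L) ≤ s * (L * (t * L)) := by
          have : t * L ≤ L * (t * L) := by
            have : 0 ≤ t * L := by positivity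
            nlinarith
          gcongr
        linarith
      have : s * (#W * s) ≤ s * (L ^ 2 * t) := by linarith
      exact le_of_mul_le_mul_left this hs0
    refine ⟨(S1 U W, F1 U W), ?_, ?_, ?_, ?_, ?_⟩
    · refine Finset.mem_biUnion.2 ⟨U, Finset.mem_filter.2 ⟨Finset.mem_powerset.2 hUQ, hUm⟩, ?_⟩
      refine Finset.mem_image.2 ⟨W, ?_, rfl⟩
      simp only [fam2, if_pos hTM]
      exact Finset.mem_filter.2 ⟨Finset.mem_powerset.2 hWT, hWm⟩
    · intro u hu
      exact Finset.mem_sdiff.2 ⟨hCS2 hu, fun h => hWC u h hu⟩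
    · refine Finset.union_subset hF2G ?_
      intro v hv
      simp only [Finset.mem_filter, Finset.mem_sdiff, Finset.mem_univ, true_and] at hv
      by_contra hvG
      have h1 := hW3 v (by simp [hv.1, hvG])
      have h2 : N v \ (Finset.univ \ S2 U ∪ W.biUnion N) = N v ∩ S1 U W := by
        ext y; simp [S1]
      rw [h2] at h1
      linarith [hv.2]
    · intro u hu
      have h1 := (Finset.mem_filter.1 (Finset.mem_sdiff.1 hu).1).2
      refine h1.trans ?_
      exact_mod_cast Finset.card_le_card
        (Finset.inter_subset_inter subset_rfl Finset.subset_union_left)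
    · intro v hvX hvF
      have h1 : (#(N v ∩ S1 U W) : ℝ) ≤ ψ := by
        by_contra! h
        exact hvF (Finset.mem_union_right _ (Finset.mem_filter.2 ⟨by simp [hvX], h⟩))
      have h2 : N v \ S1 U W ⊆ N v ∩ (X \ S1 U W) := by
        intro y hy
        rw [Finset.mem_sdiff] at hy
        exact Finset.mem_inter.2 ⟨hy.1, Finset.mem_sdiff.2 ⟨bipX v hvX hy.1, hy.2⟩⟩
      have h3 : (#(N v \ S1 U W) : ℝ) ≤ #(N v ∩ (X \ S1 U W)) := by
        exact_mod_cast Finset.card_le_card h2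
      have h4 : (#(N v \ S1 U W) : ℝ) + #(N v ∩ S1 U W) = d := by
        rw [← reg v]; exact_mod_cast Finset.card_sdiff_add_card_inter (N v) (S1 U W)
      simp only
      linarith

end Stmt18Aux

theorem stmt18 :
    ∃ C K : ℝ, 0 < C ∧ 0 < K ∧
      ∀ (n : ℕ) (F : Type) [AddCommGroup F] [Fintype F],
        Fintype.card F = 2 * n →
        ∀ X : AddSubgroup F, X.index = 2 →
          ∀ D : Set F, D ⊆ ((↑X : Set F))ᶜ → (∀ x ∈ D, -x ∈ D) →
            AddSubgroup.closure D = ⊤ →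
            ∀ d : ℕ, D.ncard = d →
              C * (logb 2 d) ^ (8 : ℕ) * logb 2 n ≤ (d : ℝ) →
              (d : ℝ) ≤ (n : ℝ) ^ ((1 : ℝ) / 3) →
              (d : ℝ) * (logb 2 d) ^ (3 : ℕ) ≤ ((D + D).ncard : ℝ) →
              ∀ a g : ℕ, ∀ F₀ : Set F, F₀ ⊆ ((↑X : Set F))ᶜ →
                ∃ 𝒞₃ : Set (Set F × Set F),
                  (𝒞₃.ncard : ℝ) ≤
                    2 ^ (K * ((g : ℝ) - (a : ℝ)) * (logb 2 d) ^ 4 / Real.sqrt d) ∧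
                  ∀ A : Set F, A ⊆ (↑X : Set F) → TwoLinked D A →
                    2 * (closureSet D (↑X) A).ncard ≤ n →
                    (closureSet D (↑X) A).ncard = a → (A + D).ncard = g →
                    IsPhiApprox D (↑X) A ((d : ℝ) - Real.sqrt d / logb 2 d) F₀ →
                    ∃ p ∈ 𝒞₃,
                      IsPsiApprox D (↑X) A d ((d : ℝ) / logb 2 d) p.1 p.2 := by
  classical
  refine ⟨4, 12, by norm_num, by norm_num, ?_⟩
  intro n F _ _ hcard X hX D hDX hsymD hgen d hd hC hdn _ a g F₀ hF₀
  by_cases hd2 : d ≤ 1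
  · refine ⟨∅, by simp; positivity, ?_⟩
    intro A hAX hlink hsmall _ _ _
    exfalso
    have hne : A.Nonempty := by
      obtain ⟨x⟩ := hlink.nonempty
      exact ⟨x.1, x.2⟩
    obtain ⟨x, hx⟩ := hne
    have hxc : x ∈ closureSet D (↑X) A :=
      ⟨hAX hx, Set.add_subset_add_right (Set.singleton_subset_iff.2 hx)⟩
    have hpos : 0 < (closureSet D (↑X) A).ncard := (Set.ncard_pos (Set.toFinite _)).2 ⟨x, hxc⟩
    have hn2 : 2 ≤ n := by omega
    have hle : Nat.card F ≤ 2 := by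
      have hs : D.Subsingleton := by
        rw [← hd] at hd2
        exact (Set.ncard_le_one_iff_subsingleton).1 hd2
      rcases hs.eq_empty_or_singleton with h0 | ⟨y, hy⟩
      · rw [h0, AddSubgroup.closure_empty] at hgen
        rw [← AddSubgroup.card_top, ← hgen]
        simp
      · have hyy : -y = y := by
          have := hsymD y (by rw [hy]; rfl)
          rw [hy] at this
          exact this
        rw [← AddSubgroup.card_top, ← hgen, hy, ← AddSubgroup.zmultiples_eq_closure,
          Nat.card_zmultiples]
        apply addOrderOf_le_of_nsmul_eq_zero (by norm_num)
        rw [two_nsmul]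
        nth_rewrite 1 [← hyy]
        simp
    rw [Nat.card_eq_fintype_card, hcard] at hle
    omega
  push Not at hd2
  have hdpos : (0 : ℝ) < d := by positivity
  have hd2' : (2 : ℝ) ≤ d := by exact_mod_cast hd2
  have hL1 : 1 ≤ logb 2 (d : ℝ) := by
    rw [Real.le_logb_iff_rpow_le (by norm_num) hdpos]; simpa using hd2'
  have hnpos : (0 : ℝ) < n := by
    rcases Nat.eq_zero_or_pos n with h | h
    · subst h
      rw [Nat.cast_zero, Real.zero_rpow (by norm_num)] at hdn
      linarith
    · exact_mod_cast h
  have hlogn : logb 2 (d : ℝ) ≤ logb 2 (n : ℝ) := by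
    have h1 : logb 2 (d : ℝ) ≤ logb 2 ((n : ℝ) ^ ((1 : ℝ) / 3)) :=
      Real.logb_le_logb_of_le (by norm_num) hdpos hdn
    rw [Real.logb_rpow_eq_mul_logb_of_pos hnpos] at h1
    linarith
  have hL9 : 4 * logb 2 (d : ℝ) ^ 9 ≤ d := by
    calc 4 * logb 2 (d : ℝ) ^ 9 = 4 * logb 2 (d : ℝ) ^ 8 * logb 2 (d : ℝ) := by ring
      _ ≤ 4 * logb 2 (d : ℝ) ^ 8 * logb 2 (n : ℝ) := by gcongr
      _ ≤ d := hC
  have hd4 : (4 : ℝ) ≤ d := by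
    have : 1 ≤ logb 2 (d : ℝ) ^ 9 := one_le_pow₀ hL1
    linarith
  have hL2 : 2 ≤ logb 2 (d : ℝ) := by
    rw [Real.le_logb_iff_rpow_le (by norm_num) hdpos]; norm_num; exact_mod_cast hd4
  have hLs : logb 2 (d : ℝ) ^ 2 ≤ √(d : ℝ) := by
    apply Real.le_sqrt_of_sq_le
    have : logb 2 (d : ℝ) ^ 4 ≤ logb 2 (d : ℝ) ^ 9 := pow_le_pow_right₀ hL1 (by norm_num)
    have h9 : 0 ≤ logb 2 (d : ℝ) ^ 9 := by positivity
    have h2 : (logb 2 (d : ℝ) ^ 2) ^ 2 = logb 2 (d : ℝ) ^ 4 := by ring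
    rw [h2]
    linarith
  obtain ⟨Df, rfl⟩ := (Set.toFinite D).exists_finset_coe
  obtain ⟨Ff, rfl⟩ := (Set.toFinite F₀).exists_finset_coe
  obtain ⟨Xf, hXf⟩ := (Set.toFinite (X : Set F)).exists_finset_coe
  have hXmem : ∀ y, y ∈ Xf ↔ y ∈ X := by
    intro y; rw [← Finset.mem_coe, hXf]; rfl
  let N : F → Finset F := fun u => Df.image (fun x => u + x)
  have hNmem : ∀ u y, y ∈ N u ↔ ∃ x ∈ Df, u + x = y := by
    intro u y; simp only [N, Finset.mem_image]
  have hN : ∀ u : F, ({u} : Set F) + (Df : Set F) = (N u : Set F) := by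
    intro u; simp [N, Set.singleton_add]
  have hNA : ∀ (A : Set F) (y : F), y ∈ A + (Df : Set F) ↔ ∃ u ∈ A, y ∈ N u := by
    intro A y
    simp only [Set.mem_add, hNmem, Finset.mem_coe]
  have sym : ∀ u v, u ∈ N v → v ∈ N u := by
    intro u v h
    obtain ⟨x, hx, rfl⟩ := (hNmem _ _).1 h
    exact (hNmem _ _).2 ⟨-x, by exact_mod_cast hsymD x (by exact_mod_cast hx), by abel⟩
  have reg : ∀ u, (N u).card = d := by
    intro u
    rw [← hd, Set.ncard_coe_finset]
    exact Finset.card_image_of_injective _ (add_right_injective u)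
  have bipX : ∀ v, v ∉ Xf → N v ⊆ Xf := by
    intro v hv y hy
    obtain ⟨x, hx, rfl⟩ := (hNmem _ _).1 hy
    rw [hXmem] at hv ⊢
    have hxX : x ∉ X := hDX (by exact_mod_cast hx)
    rw [AddSubgroup.add_mem_iff_of_index_two hX]
    tauto
  have bipY : ∀ v, v ∈ Xf → ∀ y ∈ N v, y ∉ Xf := by
    intro v hv y hy
    obtain ⟨x, hx, rfl⟩ := (hNmem _ _).1 hy
    rw [hXmem] at hv ⊢
    have hxX : x ∉ X := hDX (by exact_mod_cast hx)
    rw [AddSubgroup.add_mem_iff_of_index_two hX]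
    tauto
  obtain ⟨𝒞, h𝒞, hmain⟩ := Stmt18Aux.core N sym d reg Xf bipX (by omega) hL2 hLs a g Ff
  refine ⟨(fun p : Finset F × Finset F => ((p.1 : Set F), (p.2 : Set F))) '' (𝒞 : Set _), ?_, ?_⟩
  · refine le_trans ?_ h𝒞
    rw [← Set.ncard_coe_finset 𝒞]
    exact Nat.cast_le.2 (Set.ncard_image_le (Set.toFinite _))
  intro A hAX _ _ ha hg happ
  obtain ⟨C, hCf⟩ := (Set.toFinite (closureSet (Df : Set F) (↑X) A)).exists_finset_coe
  obtain ⟨G, hGf⟩ := (Set.toFinite (A + (Df : Set F))).exists_finset_coe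
  have hCmem : ∀ y, y ∈ C ↔ y ∈ closureSet (Df : Set F) (↑X) A := by
    intro y; rw [← hCf]; rfl
  have hgood : Stmt18Aux.Good N Xf ((d : ℝ) - √(d : ℝ) / logb 2 d) Ff C G := by
    obtain ⟨p1, p2, p3⟩ := happ
    rw [← hGf] at p1 p2
    rw [← hCf] at p2 p3
    refine ⟨?_, ?_, ?_, ?_, ?_, ?_⟩
    · intro u hu
      exact (hXmem u).2 ((hCmem u).1 hu).1
    · intro v hv
      rw [← Finset.mem_coe, hGf, hNA] at hv
      obtain ⟨u, hu, hvu⟩ := hv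
      exact bipY u ((hXmem u).2 (hAX hu)) v hvu
    · intro u hu
      have := ((hCmem u).1 hu).2
      rw [hN, ← hGf] at this
      exact_mod_cast this
    · exact_mod_cast p1
    · intro v hv hφ
      have : v ∈ (Ff : Set F) := by
        apply p2
        refine ⟨hv, ?_⟩
        rw [hN, ← Finset.coe_inter, Set.ncard_coe_finset]
        exact hφ
      exact_mod_cast this
    · intro u hu
      have := p3 hu
      rw [hNA] at this
      obtain ⟨v, hv, hvu⟩ := this
      exact ⟨v, hv, sym _ _ hvu⟩
  obtain ⟨p, hp, q1, q2, q3, q4⟩ := hmain C G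
    (by rw [← ha, ← hCf, Set.ncard_coe_finset]) (by rw [← hg, ← hGf, Set.ncard_coe_finset]) hgood
  refine ⟨_, Set.mem_image_of_mem _ hp, ?_, ?_, ?_, ?_⟩
  · rw [← hCf]; exact_mod_cast q1
  · rw [← hGf]; exact_mod_cast q2
  · intro u hu
    rw [hN, ← Finset.coe_inter, Set.ncard_coe_finset]
    exact q3 u hu
  · intro v hv
    rw [hN, ← hXf, ← Finset.coe_sdiff, ← Finset.coe_inter, Set.ncard_coe_finset]
    exact q4 v (fun h => hv.1 ((hXmem v).1 h)) hv.2
end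

section
/- There exist constants c > 0 and C > 0 such that for every integer d ≥ 3 and every positive integer n divisible by 4d − 2 with n ≥ C·d, there exists a d-regular bipartite simple graph G on 2n vertices such that G remains connected after deleting any set of fewer than d − 1 edges (i.e., G is (d−1)-edge-connected), and the number of independent sets of G satisfies i(G) ≥ 2^{n + c·n/d}. -/
/-- The number of independent sets of a finite simple graph (including the empty set). -/
noncomputable def numIndSets {V : Type*} [Fintype V] (G : SimpleGraph V) : ℕ :=
  Nat.card {s : Set V // ∀ ⦃u v : V⦄, u ∈ s → v ∈ s → ¬ G.Adj u v}

namespace Stmt19Aux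

/-- Left vertices of a block. -/
abbrev LA (e : ℕ) := Fin e ⊕ Option (Fin e)
/-- Right vertices of a block. -/
abbrev LB (e : ℕ) := Option (Fin e) ⊕ Fin e

variable {I : Type} {e : ℕ}

/-- The neighbours of a left vertex. -/
def nbA (nx : Equiv.Perm I) (h : ℕ) : I × LA e → Option (Fin e) → I × LB e
  | (i, Sum.inl _), o => (i, Sum.inl o)
  | (i, Sum.inr (some x)), none => (i, Sum.inl (some x))
  | (i, Sum.inr (some _)), some y => (i, Sum.inr y)
  | (i, Sum.inr none), none => (i, Sum.inl none)
  | (i, Sum.inr none), some y => (if y.1 < h then nx i else i, Sum.inr y)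

/-- The neighbours of a right vertex. -/
def nbB (nx : Equiv.Perm I) (h : ℕ) : I × LB e → Option (Fin e) → I × LA e
  | (j, Sum.inl _), some x => (j, Sum.inl x)
  | (j, Sum.inl o), none => (j, Sum.inr o)
  | (j, Sum.inr _), some x => (j, Sum.inr (some x))
  | (j, Sum.inr y), none => (if y.1 < h then nx.symm j else j, Sum.inr none)

lemma nbA_inj (nx : Equiv.Perm I) (h : ℕ) (u : I × LA e) : Function.Injective (nbA nx h u) := by
  rcases u with ⟨i, x | _ | x⟩ <;> rintro (_ | y) (_ | z) hyz <;> simp_all [nbA]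

lemma nbB_inj (nx : Equiv.Perm I) (h : ℕ) (u : I × LB e) : Function.Injective (nbB nx h u) := by
  rcases u with ⟨i, x | x⟩ <;> rintro (_ | y) (_ | z) hyz <;> simp_all [nbB]

lemma nb_iff (nx : Equiv.Perm I) (h : ℕ) (u : I × LA e) (v : I × LB e) :
    (∃ o, nbA nx h u o = v) ↔ ∃ o, nbB nx h v o = u := by
  rcases u with ⟨i, x | _ | x⟩ <;> rcases v with ⟨j, (_ | y) | y⟩ <;>
    simp only [Option.exists, nbA, nbB, Prod.mk.injEq, reduceCtorEq, and_false, false_or, or_false,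
      exists_false, Sum.inl.injEq, Sum.inr.injEq, and_true, Option.some.injEq, exists_and_left,
      exists_eq, exists_eq_right, exists_const] <;>
    grind [Equiv.symm_apply_apply, Equiv.apply_symm_apply]

/-- Vertices. -/
abbrev VV (I : Type) (e : ℕ) := (I × LA e) ⊕ (I × LB e)

/-- The graph. -/
def GG (nx : Equiv.Perm I) (h : ℕ) : SimpleGraph (VV I e) where
  Adj
    | Sum.inl u, Sum.inr v => ∃ o, nbA nx h u o = v
    | Sum.inr v, Sum.inl u => ∃ o, nbA nx h u o = v
    | _, _ => False
  symm := ⟨by rintro (u | u) (v | v) huv <;> exact huv⟩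
  loopless := ⟨by rintro (u | u) huv <;> exact huv⟩

lemma GG_colorable (nx : Equiv.Perm I) (h : ℕ) : (GG nx h : SimpleGraph (VV I e)).Colorable 2 := by
  refine ⟨SimpleGraph.Coloring.mk (Sum.elim (fun _ => 0) (fun _ => 1)) ?_⟩
  rintro (u | u) (v | v) huv
  · exact huv.elim
  · simp
  · simp
  · exact huv.elim

lemma GG_deg (nx : Equiv.Perm I) (h : ℕ) (v : VV I e) :
    ((GG nx h).neighborSet v).ncard = e + 1 := by
  have key : ∀ f : Option (Fin e) → VV I e, Function.Injective f → (Set.range f).ncard = e + 1 := by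
    intro f hf
    rw [← Set.image_univ, Set.ncard_image_of_injective _ hf, Set.ncard_univ]
    simp
  rcases v with u | u
  · rw [← key (fun o => Sum.inr (nbA nx h u o)) (Sum.inr_injective.comp (nbA_inj nx h u))]
    congr 1
    ext (w | w)
    · simp [GG]
    · simp [GG]
  · rw [← key (fun o => Sum.inl (nbB nx h u o)) (Sum.inl_injective.comp (nbB_inj nx h u))]
    congr 1
    ext (w | w)
    · simpa [GG] using nb_iff nx h w u
    · simp [GG]

lemma exists_not_mem {T S : Type} [Finite S] [Fintype T] {E : Set S} (hE : E.ncard < e)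
    (f : T → S) (hf : Function.Injective f) (hT : e ≤ Fintype.card T) : ∃ t, f t ∉ E := by
  by_contra! hcon
  have h1 : (Set.range f).ncard ≤ E.ncard :=
    Set.ncard_le_ncard (by rintro _ ⟨t, rfl⟩; exact hcon t) (Set.toFinite _)
  rw [← Set.image_univ, Set.ncard_image_of_injective _ hf, Set.ncard_univ,
    Nat.card_eq_fintype_card] at h1
  omega

lemma bip_conn {V X Y : Type} [Finite V] [Fintype X] [Fintype Y] {G : SimpleGraph V}
    {E : Set (Sym2 V)} (hE : E.ncard < e) (p : X → V) (q : Y → V)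
    (hp : Function.Injective p) (hq : Function.Injective q)
    (hadj : ∀ x y, G.Adj (p x) (q y)) (hX : e ≤ Fintype.card X) (hY : e ≤ Fintype.card Y) :
    (∀ x x', (G.deleteEdges E).Reachable (p x) (p x')) ∧
    (∀ x y, (G.deleteEdges E).Reachable (p x) (q y)) := by
  have hne : ∀ x y, p x ≠ q y := fun x y => (hadj x y).ne
  have A : ∀ x x', (G.deleteEdges E).Reachable (p x) (p x') := by
    intro x x'
    classical
    obtain ⟨y, hy⟩ := exists_not_mem hE
      (fun y : Y => if s(p x, q y) ∈ E then s(p x, q y) else s(p x', q y)) (by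
        intro y y' hyy
        have : ∀ a b, s(p a, q y) = s(p b, q y') → y = y' := by
          intro a b hab
          rcases Sym2.eq_iff.1 hab with ⟨_, h2⟩ | ⟨h1, _⟩
          · exact hq h2
          · exact absurd h1 (hne _ _)
        dsimp only at hyy
        split_ifs at hyy <;> exact this _ _ hyy) hY
    split_ifs at hy with h1
    · exact absurd h1 hy
    have r1 : (G.deleteEdges E).Adj (p x) (q y) := SimpleGraph.deleteEdges_adj.2 ⟨hadj x y, h1⟩
    have r2 : (G.deleteEdges E).Adj (p x') (q y) := SimpleGraph.deleteEdges_adj.2 ⟨hadj x' y, hy⟩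
    exact r1.reachable.trans r2.reachable.symm
  refine ⟨A, fun x y => ?_⟩
  obtain ⟨x', hx'⟩ := exists_not_mem hE (fun x : X => s(p x, q y)) (by
    intro a b hab
    rcases Sym2.eq_iff.1 hab with ⟨h1, _⟩ | ⟨h1, _⟩
    · exact hp h1
    · exact absurd h1 (hne _ _)) hX
  have r1 : (G.deleteEdges E).Adj (p x') (q y) := SimpleGraph.deleteEdges_adj.2 ⟨hadj x' y, hx'⟩
  exact (A x x').trans r1.reachable

lemma cycle_conn (nx : Equiv.Perm I) (htr : ∀ i j : I, ∃ m : ℕ, nx^[m] i = j)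
    (r : I → I → Prop) (hr : Equivalence r) (i0 : I) (hs : ∀ i, i ≠ i0 → r i (nx i)) (i j : I) :
    r i j := by
  have key : ∀ j, r (nx i0) j := by
    intro j
    classical
    have hm := Nat.find_spec (htr (nx i0) j)
    have hmin := fun s => Nat.find_min (htr (nx i0) j) (m := s)
    set m := Nat.find (htr (nx i0) j) with hmdef
    have : ∀ s ≤ m, r (nx i0) (nx^[s] (nx i0)) := by
      intro s
      induction s with
      | zero => intro _; exact hr.refl _
      | succ s ih =>
        intro hsm
        refine hr.trans (ih (by omega)) ?_
        rw [Function.iterate_succ_apply']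
        apply hs
        intro hbad
        apply hmin (m - (s + 1)) (by omega)
        rw [← hm]
        have : nx^[s+1] (nx i0) = nx i0 := by rw [Function.iterate_succ_apply', hbad]
        conv_rhs => rw [show m = (m - (s+1)) + (s+1) by omega, Function.iterate_add_apply, this]
    rw [← hm]
    exact this m le_rfl
  exact hr.trans (hr.symm (key i)) (key j)

/-- Choice of link edges. -/
def psi (e h : ℕ) (b : Bool) (t : Fin h) : Option (Fin e) :=
  if hlt : (if b then t.1 else t.1 + h) < e then some ⟨_, hlt⟩ else none

lemma psi_inj {h : ℕ} (hh : 2 * h ≤ e + 1) (he : 2 ≤ e) {b b' : Bool} {t t' : Fin h}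
    (heq : psi e h b t = psi e h b' t') : b = b' ∧ t = t' := by
  have := t.2
  have := t'.2
  rcases b <;> rcases b' <;> simp only [psi, Bool.false_eq_true, if_true, if_false] at heq <;>
    split_ifs at heq <;> simp at heq <;> simp [Fin.ext_iff] <;> omega

lemma GG_conn [Fintype I] [Nonempty I] (nx : Equiv.Perm I)
    (htr : ∀ i j : I, ∃ m : ℕ, nx^[m] i = j) (he : 2 ≤ e)
    (h : ℕ) (hh : 2 * h ≤ e + 1) (hh' : e ≤ 2 * h)
    (E : Set (Sym2 (VV I e))) (hE : E.ncard < e) :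
    ((GG nx h).deleteEdges E).Connected := by
  set G : SimpleGraph (VV I e) := GG nx h with hG
  set G' := G.deleteEdges E with hG'
  have adjA : ∀ u o, G.Adj (Sum.inl u) (Sum.inr (nbA nx h u o)) := fun u o => ⟨o, rfl⟩
  let x0 : Fin e := ⟨0, by omega⟩
  let c : I → VV I e := fun i => Sum.inl (i, Sum.inl x0)
  -- the two complete bipartite pieces
  have P : ∀ i, _ := fun i => bip_conn (G := G) hE (fun x : Fin e => (Sum.inl (i, Sum.inl x) : VV I e))
    (fun o : Option (Fin e) => Sum.inr (i, Sum.inl o)) (by intro a b; simp) (by intro a b; simp)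
    (fun x y => adjA (i, Sum.inl x) y) (by simp) (by simp)
  have Q : ∀ i, _ := fun i => bip_conn (G := G) hE
    (fun x : Fin e => (Sum.inl (i, Sum.inr (some x)) : VV I e))
    (fun y : Fin e => Sum.inr (i, Sum.inr y)) (by intro a b; simp) (by intro a b; simp)
    (fun x y => adjA (i, Sum.inr (some x)) (some y)) (by simp) (by simp)
  have cpa : ∀ i x, G'.Reachable (c i) (Sum.inl (i, Sum.inl x)) := fun i x => (P i).1 _ _
  have cpb : ∀ i o, G'.Reachable (c i) (Sum.inr (i, Sum.inl o)) := fun i o => (P i).2 _ _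
  have cqa : ∀ i x, G'.Reachable (c i) (Sum.inl (i, Sum.inr (some x))) := by
    intro i x
    obtain ⟨z, hz⟩ := exists_not_mem hE (fun z : Fin e =>
      (s(Sum.inl (i, Sum.inr (some z)), Sum.inr (i, Sum.inl (some z))) : Sym2 (VV I e)))
      (by intro a b; simp) (by simp)
    have r1 : G'.Adj (Sum.inl (i, Sum.inr (some z))) (Sum.inr (i, Sum.inl (some z))) :=
      SimpleGraph.deleteEdges_adj.2 ⟨adjA (i, Sum.inr (some z)) none, hz⟩
    exact ((cpb i _).trans r1.reachable.symm).trans ((Q i).1 _ _)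
  have cqb : ∀ i y, G'.Reachable (c i) (Sum.inr (i, Sum.inr y)) := fun i y =>
    (cqa i x0).trans ((Q i).2 _ _)
  -- links
  let ca : I → I × LA e := fun i => (i, Sum.inr none)
  let F : I × Bool → Fin h → Sym2 (VV I e) := fun l t =>
    s(Sum.inl (ca l.1), Sum.inr (nbA nx h (ca l.1) (psi e h l.2 t)))
  have Finj : ∀ l l' t t', F l t = F l' t' → l = l' ∧ t = t' := by
    rintro ⟨i, b⟩ ⟨i', b'⟩ t t' hF
    simp only [F, Sym2.eq_iff, Sum.inl.injEq, Sum.inr.injEq, reduceCtorEq, false_and, and_false,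
      or_false] at hF
    obtain ⟨h1, h2⟩ := hF
    have h3 : i = i' := congrArg Prod.fst h1
    subst h3
    obtain ⟨h4, h5⟩ := psi_inj hh he (nbA_inj _ _ _ h2)
    exact ⟨by rw [h4], h5⟩
  have two : ∀ l l', l ≠ l' → (∃ t, F l t ∉ E) ∨ (∃ t, F l' t ∉ E) := by
    intro l l' hll
    obtain ⟨t | t, ht⟩ := exists_not_mem hE (Sum.elim (F l) (F l')) (by
      rintro (a | a) (b | b) hab
      · exact congrArg _ (Finj _ _ _ _ hab).2
      · exact absurd (Finj _ _ _ _ hab).1 hll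
      · exact absurd (Finj _ _ _ _ hab).1.symm hll
      · exact congrArg _ (Finj _ _ _ _ hab).2) (by simp; omega)
    · exact Or.inl ⟨t, ht⟩
    · exact Or.inr ⟨t, ht⟩
  have own : ∀ i, (∃ t, F (i, false) t ∉ E) → G'.Reachable (c i) (Sum.inl (ca i)) := by
    rintro i ⟨t, ht⟩
    have r1 : G'.Adj _ _ := SimpleGraph.deleteEdges_adj.2 ⟨adjA (ca i) (psi e h false t), ht⟩
    refine SimpleGraph.Reachable.trans ?_ r1.reachable.symm
    by_cases hlt : t.1 + h < e
    · have h0 : psi e h false t = some ⟨t.1 + h, hlt⟩ := by simp [psi, hlt]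
      have h1 : ¬ (t.1 + h < h) := by omega
      have h2 := cqb i ⟨t.1 + h, hlt⟩
      rw [h0]
      simpa only [nbA, ca, h1, if_false] using h2
    · have h0 : psi e h false t = none := by simp [psi, hlt]
      rw [h0]
      exact cpb i none
  have nxt : ∀ i, (∃ t, F (i, true) t ∉ E) → G'.Reachable (c (nx i)) (Sum.inl (ca i)) := by
    rintro i ⟨t, ht⟩
    have r1 : G'.Adj _ _ := SimpleGraph.deleteEdges_adj.2 ⟨adjA (ca i) (psi e h true t), ht⟩
    refine SimpleGraph.Reachable.trans ?_ r1.reachable.symm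
    have := t.2
    have hlt : t.1 < e := by omega
    simp only [psi, if_true, hlt, dif_pos]
    simpa [nbA, ca] using cqb (nx i) _
  obtain ⟨i0, hi0⟩ : ∃ i0, ∀ i b, i ≠ i0 → ∃ t, F (i, b) t ∉ E := by
    by_cases hall : ∀ l, ∃ t, F l t ∉ E
    · exact ⟨Classical.arbitrary I, fun i b _ => hall _⟩
    · push Not at hall
      obtain ⟨⟨i0, b0⟩, hb⟩ := hall
      refine ⟨i0, fun i b hi => ?_⟩
      rcases two (i, b) (i0, b0) (by simp [hi]) with h1 | ⟨t, ht⟩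
      · exact h1
      · exact absurd (hb t) ht
  have cc : ∀ i j, G'.Reachable (c i) (c j) := by
    refine cycle_conn nx htr (fun i j => G'.Reachable (c i) (c j))
      ⟨fun _ => SimpleGraph.Reachable.refl _, fun h => h.symm, fun h h' => h.trans h'⟩ i0 ?_
    intro i hi
    exact (own i (hi0 i _ hi)).trans (nxt i (hi0 i _ hi)).symm
  let i1 : I := Classical.arbitrary I
  have all : ∀ v, G'.Reachable (c i1) v := by
    rintro (⟨i, x | _ | x⟩ | ⟨i, x | x⟩)
    · exact (cc _ i).trans (cpa i x)
    · rcases two (i, false) (i, true) (by simp) with h1 | h1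
      · exact (cc _ i).trans (own i h1)
      · exact (cc _ _).trans (nxt i h1)
    · exact (cc _ i).trans (cqa i x)
    · exact (cc _ i).trans (cpb i x)
    · exact (cc _ i).trans (cqb i x)
  haveI : Nonempty (VV I e) := ⟨c i1⟩
  exact ⟨fun u v => (all u).symm.trans (all v)⟩

/-- The cyclic successor. -/
def nxt (k : ℕ) : Equiv.Perm (ZMod k × Bool) where
  toFun := fun p => if p.2 then (p.1 + 1, false) else (p.1, true)
  invFun := fun p => if p.2 then (p.1, false) else (p.1 - 1, true)
  left_inv := by rintro ⟨a, _ | _⟩ <;> simp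
  right_inv := by rintro ⟨a, _ | _⟩ <;> simp

lemma nxt_tr (k : ℕ) [NeZero k] (i j : ZMod k × Bool) : ∃ m : ℕ, (nxt k)^[m] i = j := by
  have h1 : ∀ (m : ℕ) (a : ZMod k), (nxt k)^[2 * m] (a, false) = (a + m, false) := by
    intro m
    induction m with
    | zero => intro a; simp
    | succ m ih =>
      intro a
      rw [show 2 * (m + 1) = (2 * m + 1) + 1 by ring, Function.iterate_succ_apply',
        Function.iterate_succ_apply', ih]
      simp [nxt, add_assoc]
  have h2 : ∀ (a : ZMod k) (j : ZMod k × Bool), ∃ m : ℕ, (nxt k)^[m] (a, false) = j := by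
    rintro a ⟨b, c⟩
    have h3 := h1 (b - a).val a
    rw [ZMod.natCast_zmod_val, add_sub_cancel] at h3
    rcases c
    · exact ⟨_, h3⟩
    · refine ⟨2 * (b - a).val + 1, ?_⟩
      rw [Function.iterate_succ_apply', h3]
      simp [nxt]
  obtain ⟨a, b⟩ := i
  rcases b
  · exact h2 a j
  · obtain ⟨m, hm⟩ := h2 (a + 1) j
    refine ⟨m + 1, ?_⟩
    rw [Function.iterate_succ_apply]
    simpa [nxt] using hm

/-- Local choices. -/
abbrev XX (e : ℕ) := Set (Bool × LA e) ⊕ Set ((Fin e ⊕ Fin e) ⊕ (Fin e ⊕ Fin e))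

/-- Membership of left vertices. -/
def memA (b : Bool) (α : LA e) : XX e → Prop
  | Sum.inl T => (b, α) ∈ T
  | Sum.inr T => b = false ∧ ∃ z : Fin e ⊕ Fin e, Sum.map id some z = α ∧ Sum.inl z ∈ T

/-- Membership of right vertices. -/
def memB (b : Bool) (β : LB e) : XX e → Prop
  | Sum.inl _ => False
  | Sum.inr T => b = true ∧ (β = Sum.inl none ∨
      ∃ z : Fin e ⊕ Fin e, Sum.map some id z = β ∧ Sum.inr z ∈ T)

/-- The set coming from local choices. -/
def SS {k : ℕ} (F : ZMod k → XX e) : Set (VV (ZMod k × Bool) e)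
  | Sum.inl ((j, b), α) => memA b α (F j)
  | Sum.inr ((j, b), β) => memB b β (F j)

lemma SS_ind {k : ℕ} (h : ℕ) (F : ZMod k → XX e) ⦃u v : VV (ZMod k × Bool) e⦄
    (hu : u ∈ SS F) (hv : v ∈ SS F) : ¬ (GG (nxt k) h).Adj u v := by
  have key : ∀ (u : (ZMod k × Bool) × LA e) (v : (ZMod k × Bool) × LB e),
      Sum.inl u ∈ SS F → Sum.inr v ∈ SS F → ¬ ∃ o, nbA (nxt k) h u o = v := by
    rintro ⟨⟨j, b⟩, α⟩ ⟨⟨j', b'⟩, β⟩ hu hv ⟨o, ho⟩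
    change memA b α (F j) at hu
    change memB b' β (F j') at hv
    have h1 : (j', b') = (j, b) ∨ ((j', b') = nxt k (j, b) ∧ α = Sum.inr none) := by
      have h2 := congrArg Prod.fst ho
      rcases α with x | _ | x <;> rcases o with _ | o <;> simp only [nbA] at h2
      all_goals first
        | exact Or.inl h2.symm
        | (split_ifs at h2
           · exact Or.inr ⟨h2.symm, rfl⟩
           · exact Or.inl h2.symm)
    rcases hF : F j' with T | T
    · rw [hF] at hv; exact hv
    rw [hF] at hv
    have hb' : b' = true := hv.1
    subst hb'
    rcases h1 with h1 | ⟨h1, rfl⟩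
    · obtain ⟨rfl, rfl⟩ := Prod.mk.inj h1
      rw [hF] at hu
      exact absurd hu.1 (by simp)
    · rcases b
      · simp only [nxt, Equiv.coe_fn_mk, Bool.false_eq_true, if_false, Prod.mk.injEq, and_true] at h1
        subst h1
        rw [hF] at hu
        obtain ⟨_, z | z, hz, _⟩ := hu <;> simp at hz
      · simp [nxt] at h1
  rcases u with u | u <;> rcases v with v | v
  · exact id
  · exact key u v hu hv
  · exact key v u hv hu
  · exact id

lemma SS_inj {k : ℕ} : Function.Injective (SS : (ZMod k → XX e) → _) := by
  intro F F' hFF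
  have hA : ∀ j b α, memA b α (F j) ↔ memA b α (F' j) := fun j b α =>
    Iff.of_eq (congrFun hFF (Sum.inl ((j, b), α)))
  have hB : ∀ j b β, memB b β (F j) ↔ memB b β (F' j) := fun j b β =>
    Iff.of_eq (congrFun hFF (Sum.inr ((j, b), β)))
  funext j
  replace hA := hA j
  replace hB := hB j
  rcases hj : F j with T | T <;> rcases hj' : F' j with T' | T' <;> rw [hj, hj'] at hA hB
  · congr 1
    ext ⟨b, α⟩
    exact hA b α
  · have := hB true (Sum.inl none)
    simp [memB] at this
  · have := hB true (Sum.inl none)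
    simp [memB] at this
  · congr 1
    have i1 : Function.Injective (Sum.map id some : Fin e ⊕ Fin e → LA e) :=
      Sum.map_injective.2 ⟨Function.injective_id, Option.some_injective _⟩
    have i2 : Function.Injective (Sum.map some id : Fin e ⊕ Fin e → LB e) :=
      Sum.map_injective.2 ⟨Option.some_injective _, Function.injective_id⟩
    ext (z | z)
    · have := hA false (Sum.map id some z)
      simpa [memA, i1.eq_iff] using this
    · have := hB true (Sum.map some id z)
      have hz : (Sum.map some id z : LB e) ≠ Sum.inl none := by rcases z with z | z <;> simp
      simpa [memB, i2.eq_iff, hz] using this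

lemma numInd {k : ℕ} [NeZero k] (h : ℕ) :
    (5 * 2 ^ (4 * e)) ^ k ≤ numIndSets (GG (nxt k) h : SimpleGraph (VV (ZMod k × Bool) e)) := by
  have h1 : Nat.card (ZMod k → XX e) = (5 * 2 ^ (4 * e)) ^ k := by
    classical
    rw [Nat.card_eq_fintype_card]
    simp only [Fintype.card_fun, Fintype.card_sum, Fintype.card_set, Fintype.card_prod,
      Fintype.card_bool, Fintype.card_fin, Fintype.card_option, ZMod.card]
    congr 1
    rw [show 2 * (e + (e + 1)) = 4 * e + 2 by ring, show e + e + (e + e) = 4 * e by ring, pow_add]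
    ring
  rw [← h1, numIndSets]
  exact Nat.card_le_card_of_injective
    (fun F => ⟨SS F, fun u v hu hv => SS_ind h F hu hv⟩)
    (fun F F' hF => SS_inj (congrArg Subtype.val hF))

end Stmt19Aux

open Stmt19Aux in
theorem stmt19 :
    ∃ c C : ℝ, 0 < c ∧ 0 < C ∧
      ∀ d : ℕ, 3 ≤ d → ∀ n : ℕ, 0 < n → (4 * d - 2) ∣ n → C * (d : ℝ) ≤ (n : ℝ) →
        ∃ G : SimpleGraph (Fin (2 * n)),
          -- `G` is bipartite
          G.Colorable 2 ∧
          -- `G` is `d`-regular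
          (∀ v : Fin (2 * n), (G.neighborSet v).ncard = d) ∧
          -- `G` stays connected after deleting any set of fewer than `d − 1` edges
          (∀ E : Set (Sym2 (Fin (2 * n))), E.ncard < d - 1 →
            (G.deleteEdges E).Connected) ∧
          -- `G` has at least `2 ^ (n + c·n/d)` independent sets
          (2 : ℝ) ^ ((n : ℝ) + c * (n : ℝ) / (d : ℝ)) ≤ (numIndSets G : ℝ) := by
  refine ⟨1 / 16, 1, by norm_num, by norm_num, ?_⟩
  rintro d hd n hn ⟨k, hk⟩ -
  obtain ⟨e, rfl⟩ : ∃ e, d = e + 1 := ⟨d - 1, by omega⟩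
  have he : 2 ≤ e := by omega
  have hk' : n = (4 * e + 2) * k := by rw [hk]; congr 1
  haveI : NeZero k := ⟨by rintro rfl; omega⟩
  let V := VV (ZMod k × Bool) e
  have hcard : Fintype.card (Fin (2 * n)) = Fintype.card V := by
    simp only [V, Fintype.card_sum, Fintype.card_prod, Fintype.card_bool, Fintype.card_fin,
      Fintype.card_option, ZMod.card, hk']
    ring
  let φ : Fin (2 * n) ≃ V := Fintype.equivOfCardEq hcard
  let h := (e + 1) / 2
  let G0 : SimpleGraph V := GG (nxt k) h
  let G : SimpleGraph (Fin (2 * n)) := G0.comap φ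
  refine ⟨G, ?_, ?_, ?_, ?_⟩
  · exact (GG_colorable (nxt k) h).of_hom (⟨φ, fun h => h⟩ : G →g G0)
  · intro v
    rw [← GG_deg (nxt k) h (φ v)]
    have : G.neighborSet v = φ ⁻¹' (G0.neighborSet (φ v)) := rfl
    rw [this, ← Set.ncard_image_of_injective _ φ.injective, Set.image_preimage_eq _ φ.surjective]
  · intro E hE
    have hE' : (Sym2.map φ '' E).ncard < e := by
      rw [Set.ncard_image_of_injective _ (Sym2.map.injective φ.injective)]
      simpa using hE
    have hc := GG_conn (nxt k) (nxt_tr k) he h (by omega) (by omega) _ hE'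
    let ι : G.deleteEdges E ≃g (GG (nxt k) h).deleteEdges (Sym2.map φ '' E) :=
      ⟨φ, by
        intro a b
        simp only [SimpleGraph.deleteEdges_adj]
        rw [show s(φ a, φ b) = Sym2.map φ s(a, b) from rfl,
          (Sym2.map.injective φ.injective).mem_set_image]
        rfl⟩
    exact ι.connected_iff.2 hc
  · have h1 : numIndSets G0 ≤ numIndSets G := by
      refine Nat.card_le_card_of_injective
        (fun s => ⟨φ ⁻¹' s.1, fun u v hu hv => s.2 hu hv⟩) ?_
      intro s t hst
      exact Subtype.ext (φ.surjective.preimage_injective (congrArg Subtype.val hst))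
    have h2 := (numInd (e := e) (k := k) h).trans h1
    have h3 : ((5 * 2 ^ (4 * e)) ^ k : ℝ) ≤ numIndSets G := by exact_mod_cast h2
    refine le_trans ?_ h3
    have hkr : (n : ℝ) = (4 * e + 2) * k := by rw [hk']; push_cast; ring
    have hle : (n : ℝ) + 1 / 16 * n / ((e + 1 : ℕ) : ℝ) ≤ (4 * e + 2 + 1 / 4) * k := by
      have hpos : (0 : ℝ) < ((e + 1 : ℕ) : ℝ) := by positivity
      have : 1 / 16 * (n : ℝ) / ((e + 1 : ℕ) : ℝ) ≤ 1 / 4 * k := by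
        rw [div_le_iff₀ hpos, hkr]
        push_cast
        have : (0 : ℝ) ≤ k := by positivity
        nlinarith
      rw [hkr] at this ⊢
      linarith
    have hq : (2 : ℝ) ^ (1 / 4 : ℝ) ≤ 5 / 4 := by
      rw [show (5 / 4 : ℝ) = ((5 / 4 : ℝ) ^ (4 : ℝ)) ^ (1 / 4 : ℝ) by
        rw [← Real.rpow_mul (by norm_num)]; norm_num]
      apply Real.rpow_le_rpow (by norm_num) _ (by norm_num)
      rw [show (4 : ℝ) = ((4 : ℕ) : ℝ) by norm_num, Real.rpow_natCast]
      norm_num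
    calc (2 : ℝ) ^ ((n : ℝ) + 1 / 16 * n / ((e + 1 : ℕ) : ℝ))
        ≤ 2 ^ ((4 * e + 2 + 1 / 4 : ℝ) * k) := Real.rpow_le_rpow_of_exponent_le (by norm_num) hle
      _ = (2 ^ (4 * e + 2) * 2 ^ (1 / 4 : ℝ)) ^ k := by
        rw [Real.rpow_mul (by norm_num), Real.rpow_natCast, Real.rpow_add (by norm_num)]
        congr 2
        rw [← Real.rpow_natCast]
        push_cast
        rfl
      _ ≤ (2 ^ (4 * e + 2) * (5 / 4)) ^ k := by gcongr
      _ = (5 * 2 ^ (4 * e)) ^ k := by congr 1; rw [pow_add]; ring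
end
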